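/- For every δ ∈ (0,1) there is a constant c₃(δ) ≥ 2 depending only on d ≥ 3 and δ such that: for all integers L ≥ 1 and K ≥ c₃(δ), every nonempty A ⊆ B(0,L), every finite B ⊂ ℤ^d with B ∩ B(0,KL) = A and ℤ^d∖B connected, every y ∈ A and every x ∈ ℤ^d ∖ (B ∪ B(0,KL)), the conditioning event {H_B < ∞, X_{H_B} ∈ A} has positive P_x-probability and (1 − δ/10)·ē_A(y) ≤ P_x[X_{H_B} = y | H_B < ∞, X_{H_B} ∈ A] ≤ (1 + δ/10)·ē_A(y). -/

import Mathlib

open MeasureTheory ENNReal Set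
open scoped Classical NNReal

namespace Disconnection

/-- Points of `ℤ^d`. -/
abbrev Zd (d : ℕ) := Fin d → ℤ

/-- Step distribution of the simple random walk: uniform weight `1/(2d)` on each of the
`2d` unit vectors of `ℤ^d`. -/
noncomputable def stepP (d : ℕ) (v : Zd d) : ℝ≥0∞ :=
  if (∑ i, (v i).natAbs) = 1 then ((2 * d : ℕ) : ℝ≥0∞)⁻¹ else 0

/-- The exponential distribution of rate `1` on `[0,∞)` (as a measure on `ℝ`). -/
noncomputable def expMeasure : Measure ℝ :=
  MeasureTheory.volume.withDensity fun t => ENNReal.ofReal (if 0 < t then Real.exp (-t) else 0)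

/-- Nearest neighbours in `ℤ^d` (Euclidean distance one). -/
def adjacent {d : ℕ} (x y : Zd d) : Prop := (∑ i, (x i - y i).natAbs) = 1

/-- (Outer) boundary `∂A` of a set `A ⊆ ℤ^d`. -/
def bdry {d : ℕ} (A : Set (Zd d)) : Set (Zd d) := {y | y ∉ A ∧ ∃ x ∈ A, adjacent x y}

/-- sup-norm distance between two points of `ℤ^d`. -/
def supDist {d : ℕ} (x y : Zd d) : ℕ := Finset.univ.sup fun i => (x i - y i).natAbs

/-- closed sup-norm ball `B(x,r)` in `ℤ^d`. -/
def ball {d : ℕ} (x : Zd d) (r : ℕ) : Set (Zd d) := {y | supDist x y ≤ r}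

/-- mutual sup-norm distance between two sets. -/
noncomputable def setDist {d : ℕ} (A B : Set (Zd d)) : ℕ := sInf {n | ∃ x ∈ A, ∃ y ∈ B, supDist x y = n}

/-- the box `ℤ^d ∩ [a,b)^d`. -/
def intBox {d : ℕ} (a b : ℤ) : Set (Zd d) := {y | ∀ i, a ≤ y i ∧ y i < b}

/-- A box in `ℤ^d`: a translate of `[0,L)^d ∩ ℤ^d` with `L ≥ 1`. -/
def isBox {d : ℕ} (S : Set (Zd d)) : Prop :=
  ∃ L : ℕ, 1 ≤ L ∧ ∃ a : Zd d, S = {y | ∀ i, a i ≤ y i ∧ y i < a i + L}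

/-- connectedness of a subset of `ℤ^d` by nearest-neighbour paths. -/
def connSet {d : ℕ} (S : Set (Zd d)) : Prop :=
  ∀ a ∈ S, ∀ b ∈ S, ∃ (n : ℕ) (f : ℕ → Zd d), f 0 = a ∧ f n = b ∧
    (∀ k ≤ n, f k ∈ S) ∧ ∀ k < n, adjacent (f k) (f (k + 1))

/-- Euclidean norm of a lattice point. -/
noncomputable def eucNorm {d : ℕ} (x : Zd d) : ℝ := Real.sqrt (∑ i, ((x i : ℝ)) ^ 2)

/-- A model of the continuous-time simple random walk on `ℤ^d` with unit jump rate: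
`Y` is the discrete jump chain and `ζ` are the holding times; under `P x` one has
`Y 0 = x` a.s., and the increments of `Y` together with the holding times are mutually
independent, the increments uniform on the `2d` unit vectors and the holding times
exponential of rate `1`.  This is expressed through the finite-dimensional cylinder
probabilities, which determine the joint law. -/
structure SRW (d : ℕ) (Ω : Type*) [MeasurableSpace Ω] where
  P : Zd d → Measure Ω
  isProb : ∀ x, IsProbabilityMeasure (P x)
  Y : ℕ → Ω → Zd d
  ζ : ℕ → Ω → ℝ
  measurable_Y : ∀ n, Measurable (Y n)
  measurable_ζ : ∀ n, Measurable (ζ n)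
  Y_zero : ∀ x : Zd d, P x {ω | Y 0 ω = x} = 1
  law : ∀ (x : Zd d) (n : ℕ) (s : Fin n → Zd d) (I : Fin n → Set ℝ),
    (∀ i, MeasurableSet (I i)) →
    P x {ω | (∀ i : Fin n, Y ((i : ℕ) + 1) ω - Y (i : ℕ) ω = s i) ∧
             (∀ i : Fin n, ζ (i : ℕ) ω ∈ I i)}
      = (∏ i, stepP d (s i)) * ∏ i, expMeasure (I i)

namespace SRW

variable {d : ℕ} {Ω : Type*} [MeasurableSpace Ω]

/-- time of the `n`-th jump. -/
noncomputable def S (W : SRW d Ω) (n : ℕ) (ω : Ω) : ℝ := ∑ i ∈ Finset.range n, W.ζ i ω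

/-- index of the current step of the jump chain at time `t`. -/
noncomputable def jumpIdx (W : SRW d Ω) (t : ℝ) (ω : Ω) : ℕ := sSup {k : ℕ | W.S k ω ≤ t}

/-- the continuous-time walk `X_t`. -/
noncomputable def X (W : SRW d Ω) (t : ℝ) (ω : Ω) : Zd d := W.Y (W.jumpIdx t ω) ω

/-- entrance time of `A` after time `t` (`∞` if there is none). -/
noncomputable def hitFrom (W : SRW d Ω) (A : Set (Zd d)) (t : ℝ≥0∞) (ω : Ω) : ℝ≥0∞ :=
  sInf {u : ℝ≥0∞ | ∃ s : ℝ≥0, u = (s : ℝ≥0∞) ∧ t ≤ u ∧ W.X (s : ℝ) ω ∈ A}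

/-- entrance time `H_A = inf {t ≥ 0 : X_t ∈ A}`. -/
noncomputable def hit (W : SRW d Ω) (A : Set (Zd d)) (ω : Ω) : ℝ≥0∞ := W.hitFrom A 0 ω

/-- exit time `T_U = inf {t ≥ 0 : X_t ∉ U}`. -/
noncomputable def exit (W : SRW d Ω) (U : Set (Zd d)) (ω : Ω) : ℝ≥0∞ := W.hit Uᶜ ω

/-- hitting time `H̃_A = inf {t ≥ ζ₀ : X_t ∈ A}`. -/
noncomputable def hitTilde (W : SRW d Ω) (A : Set (Zd d)) (ω : Ω) : ℝ≥0∞ :=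
  W.hitFrom A (ENNReal.ofReal (W.ζ 0 ω)) ω

/-- the walk evaluated at a random (possibly infinite) time. -/
noncomputable def Xat (W : SRW d Ω) (τ : Ω → ℝ≥0∞) (ω : Ω) : Zd d := W.X (τ ω).toReal ω

/-- equilibrium measure `e_A(x) = P_x[H̃_A = ∞] 1_A(x)`. -/
noncomputable def eqm (W : SRW d Ω) (A : Set (Zd d)) (x : Zd d) : ℝ :=
  if x ∈ A then (W.P x {ω | W.hitTilde A ω = ⊤}).toReal else 0

/-- capacity `cap(A) = Σ_x e_A(x)`. -/
noncomputable def cap (W : SRW d Ω) (A : Set (Zd d)) : ℝ := ∑ᶠ x, W.eqm A x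

/-- normalized equilibrium measure `ē_A = e_A / cap(A)`. -/
noncomputable def ebar (W : SRW d Ω) (A : Set (Zd d)) (x : Zd d) : ℝ := W.eqm A x / W.cap A

/-- equilibrium measure of `A` relative to `U`: `e_{A,U}(x) = P_x[H̃_A > T_U] 1_A(x)`. -/
noncomputable def eqmRel (W : SRW d Ω) (A U : Set (Zd d)) (x : Zd d) : ℝ :=
  if x ∈ A then (W.P x {ω | W.exit U ω < W.hitTilde A ω}).toReal else 0

/-- `P_ρ = Σ_x ρ(x) P_x`, the walk started from the initial (sub-)measure with density `ρ`. -/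
noncomputable def Pinit (W : SRW d Ω) (ρ : Zd d → ℝ) : Measure Ω :=
  Measure.sum fun x : Zd d => ENNReal.ofReal (ρ x) • W.P x

/-- Green function `g(x,y) = E_x[∫₀^∞ 1{X_s = y} ds]`. -/
noncomputable def green (W : SRW d Ω) (x y : Zd d) : ℝ :=
  ∫ ω, (∫ s in Set.Ioi (0 : ℝ), if W.X s ω = y then (1 : ℝ) else 0) ∂ W.P x

/-- killed Green function `g_U(x,y) = E_x[∫₀^{T_U} 1{X_s = y} ds]`. -/
noncomputable def greenK (W : SRW d Ω) (U : Set (Zd d)) (x y : Zd d) : ℝ :=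
  ∫ ω, (∫ s in Set.Ioi (0 : ℝ),
      if ENNReal.ofReal s < W.exit U ω ∧ W.X s ω = y then (1 : ℝ) else 0) ∂ W.P x

/-- the potential operator `Gf(x) = Σ_y g(x,y) f(y)`. -/
noncomputable def Gop (W : SRW d Ω) (f : Zd d → ℝ) (x : Zd d) : ℝ :=
  ∑ᶠ y, W.green x y * f y

/-- successive return times to `A` (between excursions out of `U`): `Rt A U 0 = R₁ = H_A`. -/
noncomputable def Rt (W : SRW d Ω) (A U : Set (Zd d)) : ℕ → Ω → ℝ≥0∞
  | 0 => W.hit A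
  | k + 1 => fun ω => W.hitFrom A (W.hitFrom Uᶜ (W.Rt A U k ω) ω) ω

/-- successive departure times from `U`: `Dt A U k = D_{k+1}`. -/
noncomputable def Dt (W : SRW d Ω) (A U : Set (Zd d)) (k : ℕ) (ω : Ω) : ℝ≥0∞ :=
  W.hitFrom Uᶜ (W.Rt A U k ω) ω

/-- number of excursions from `A` to the complement of `U`:
`N_{A,U} = sup {k ≥ 1 : D_k < ∞}` (with `sup ∅ = 0`). -/
noncomputable def Nexc (W : SRW d Ω) (A U : Set (Zd d)) (ω : Ω) : ℕ :=
  sSup {n | 0 < n ∧ W.Dt A U (n - 1) ω < ⊤}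

end SRW

end Disconnection

open Disconnection

namespace Sol

def dv {d : ℕ} (e : Fin d × Bool) : Zd d := Pi.single e.1 (if e.2 then 1 else -1)

noncomputable def avg {d : ℕ} (g : Zd d → ℝ) (z : Zd d) : ℝ :=
  (∑ e : Fin d × Bool, g (z + dv e)) / (2 * d)

def fl {d : ℕ} (e : Fin d × Bool) : Fin d × Bool := (e.1, !e.2)

lemma dv_fl {d : ℕ} (e : Fin d × Bool) : dv (fl e) = - dv e := by
  obtain ⟨i, b⟩ := e
  ext j
  by_cases h : j = i
  · subst h; cases b <;> simp [dv, fl]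
  · cases b <;> simp [dv, fl, h]

noncomputable def nsq {d : ℕ} (z : Zd d) : ℝ := ∑ i, (z i : ℝ) ^ 2

noncomputable def hh {d : ℕ} (z : Zd d) (e : Fin d × Bool) : ℝ :=
  2 * (if e.2 then 1 else -1) * (z e.1 : ℝ) + 1

lemma nsq_add {d : ℕ} (z : Zd d) (e : Fin d × Bool) : nsq (z + dv e) = nsq z + hh z e := by
  obtain ⟨i, b⟩ := e
  unfold nsq
  rw [← Finset.add_sum_erase _ _ (Finset.mem_univ i), ← Finset.add_sum_erase _ (fun j => ((z j : ℝ))^2) (Finset.mem_univ i)]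
  have : ∀ j ∈ Finset.univ.erase i, (((z + dv (i, b)) j : ℤ) : ℝ) ^ 2 = (z j : ℝ) ^ 2 := by
    intro j hj
    have : j ≠ i := (Finset.mem_erase.mp hj).1
    simp [dv, this]
  rw [Finset.sum_congr rfl this]
  cases b <;> simp [dv, hh] <;> ring

lemma nsq_nonneg {d : ℕ} (z : Zd d) : 0 ≤ nsq z := Finset.sum_nonneg fun _ _ => sq_nonneg _

lemma sq_le_nsq {d : ℕ} (z : Zd d) (i : Fin d) : (z i : ℝ) ^ 2 ≤ nsq z :=
  Finset.single_le_sum (f := fun i => (z i : ℝ) ^ 2) (fun _ _ => sq_nonneg _) (Finset.mem_univ i)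

lemma sum_hh {d : ℕ} (z : Zd d) : ∑ e, hh z e = 2 * d := by
  rw [Fintype.sum_prod_type]
  simp [hh, Finset.sum_add_distrib]
  ring

lemma sum_hh_sq {d : ℕ} (z : Zd d) : ∑ e, hh z e ^ 2 = 8 * nsq z + 2 * d := by
  rw [Fintype.sum_prod_type]
  have : ∀ i : Fin d, ∑ b : Bool, hh z (i, b) ^ 2 = 8 * (z i : ℝ) ^ 2 + 2 := by
    intro i; simp [hh]; ring
  rw [Finset.sum_congr rfl fun i _ => this i, Finset.sum_add_distrib, ← Finset.mul_sum]
  simp [nsq]; ring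

lemma alg {d : ℕ} (w : Fin d × Bool → ℝ) (hw : ∀ e, 0 ≤ w e) (hs : ∑ e, w e = 2 * d) :
    (∑ e, (w e - 1) ^ 2) ^ 2 ≤ (2 + 8 * (d:ℝ)) ^ 2 * d *
      ∑ i, (1 - w (i, true) * w (i, false)) ^ 2 := by
  set s : Fin d → ℝ := fun i => 1 - w (i, true) * w (i, false) with hsd
  set b : Fin d → ℝ := fun i => w (i, true) + w (i, false) - 2 with hb
  have hsum : ∑ i, (w (i, true) + w (i, false)) = 2 * d := by
    rw [← hs, Fintype.sum_prod_type]; simp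
  have hb0 : ∑ i, b i = 0 := by
    simp only [hb, Finset.sum_sub_distrib, hsum]; simp; ring
  have hble : ∀ i, |b i| ≤ 2 * d := by
    intro i
    have h1 : w (i, true) + w (i, false) ≤ 2 * d := by
      rw [← hsum]
      exact Finset.single_le_sum (f := fun i => w (i, true) + w (i, false))
        (fun j _ => add_nonneg (hw _) (hw _)) (Finset.mem_univ i)
    have h2 : (1:ℝ) ≤ d := by
      have : 0 < d := i.pos
      exact_mod_cast this
    have := hw (i, true); have := hw (i, false)
    rw [abs_le]; constructor <;> simp only [hb] <;> linarith
  have h1 : ∀ i, |b i| - b i ≤ 4 * |s i| := by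
    intro i
    have := hw (i, true); have := hw (i, false)
    rcases le_total 0 (b i) with h | h
    · rw [abs_of_nonneg h]; have := abs_nonneg (s i); linarith
    · rw [abs_of_nonpos h]
      have h3 : -b i ≤ 2 * s i := by
        simp only [hb, hsd] at h ⊢
        nlinarith [sq_nonneg (w (i, true) - w (i, false))]
      linarith [le_abs_self (s i)]
  have h2 : ∑ i, |b i| ≤ 4 * ∑ i, |s i| := by
    have := Finset.sum_le_sum fun i (_ : i ∈ Finset.univ) => h1 i
    rw [Finset.sum_sub_distrib, hb0, ← Finset.mul_sum] at this
    linarith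
  have h3 : ∑ i, b i ^ 2 ≤ 2 * d * ∑ i, |b i| := by
    rw [Finset.mul_sum]
    refine Finset.sum_le_sum fun i _ => ?_
    rw [← sq_abs, sq]
    exact mul_le_mul_of_nonneg_right (hble i) (abs_nonneg _)
  have hQ : ∑ e, (w e - 1) ^ 2 = ∑ i, (2 * s i + b i ^ 2 + 2 * b i) := by
    rw [Fintype.sum_prod_type]
    refine Finset.sum_congr rfl fun i _ => ?_
    simp [hb, hsd]; ring
  have hQ2 : ∑ e, (w e - 1) ^ 2 ≤ (2 + 8 * d) * ∑ i, |s i| := by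
    rw [hQ, Finset.sum_add_distrib, Finset.sum_add_distrib, ← Finset.mul_sum, ← Finset.mul_sum, hb0]
    have : ∑ i, s i ≤ ∑ i, |s i| := Finset.sum_le_sum fun i _ => le_abs_self _
    have hd : (0:ℝ) ≤ d := Nat.cast_nonneg d
    nlinarith
  have hcs : (∑ i, |s i|) ^ 2 ≤ d * ∑ i, s i ^ 2 := by
    have := sq_sum_le_card_mul_sum_sq (s := (Finset.univ : Finset (Fin d))) (f := fun i => |s i|)
    simpa using this
  calc _ ≤ ((2 + 8 * d) * ∑ i, |s i|) ^ 2 :=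
        pow_le_pow_left₀ (Finset.sum_nonneg fun _ _ => sq_nonneg _) hQ2 2
    _ = (2 + 8 * d) ^ 2 * (∑ i, |s i|) ^ 2 := by ring
    _ ≤ (2 + 8 * d) ^ 2 * (d * ∑ i, s i ^ 2) := by gcongr
    _ = _ := by ring

noncomputable def ww {d : ℕ} (f : Zd d → ℝ) (e : Fin d × Bool) (y : Zd d) : ℝ := f (y + dv e) / f y
noncomputable def QQ {d : ℕ} (f : Zd d → ℝ) (y : Zd d) : ℝ := ∑ e, (ww f e y - 1) ^ 2

lemma sum_ww {d : ℕ} (hd : 1 ≤ d) (f : Zd d → ℝ) (x : Zd d) (hf : 0 < f x) (hx : avg f x = f x) :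
    ∑ e, ww f e x = 2 * d := by
  have : (0:ℝ) < d := by exact_mod_cast hd
  unfold ww
  rw [← Finset.sum_div]
  unfold avg at hx
  field_simp at hx ⊢
  linarith

lemma ww_pos {d : ℕ} (f : Zd d → ℝ) (hf : ∀ z, 0 < f z) (x : Zd d) (e) : 0 < ww f e x :=
  div_pos (hf _) (hf _)

lemma ww_le {d : ℕ} (hd : 1 ≤ d) (f : Zd d → ℝ) (x : Zd d) (hf : ∀ z, 0 < f z)
    (hx : avg f x = f x) (e) : ww f e x ≤ 2 * d := by
  rw [← sum_ww hd f x (hf x) hx]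
  exact Finset.single_le_sum (f := fun e => ww f e x) (fun e _ => (ww_pos f hf x e).le) (Finset.mem_univ e)

lemma bochner {d : ℕ} (hd : 1 ≤ d) (f : Zd d → ℝ) (x : Zd d) (hf : ∀ z, 0 < f z)
    (hx : avg f x = f x) (hxe : ∀ e, avg f (x + dv e) = f (x + dv e)) :
    QQ f x ^ 2 / (2 * d ^ 3 * (2 + 8 * d) ^ 2) ≤
      ∑ e, ww f e x / (2 * d) * (QQ f (x + dv e) - QQ f x) := by
  have hdp : (0:ℝ) < d := by exact_mod_cast hd
  have key : ∑ e', ww f e' x / (2 * d) * (QQ f (x + dv e') - QQ f x) =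
      ∑ e, ∑ e', ww f e' x / (2 * d) * (ww f e (x + dv e') - ww f e x) ^ 2 := by
    have h1 : ∀ e, ∑ e', ww f e' x / (2 * d) * (ww f e (x + dv e') - ww f e x) = 0 := by
      intro e
      simp only [mul_sub, Finset.sum_sub_distrib, ← Finset.sum_mul, ← Finset.sum_div,
        sum_ww hd f x (hf x) hx]
      have : ∀ e', ww f e' x / (2 * d) * ww f e (x + dv e') = f ((x + dv e) + dv e') / (2 * d) / f x := by
        intro e'
        have := (hf x).ne'; have := (hf (x + dv e')).ne'
        unfold ww
        rw [show x + dv e + dv e' = x + dv e' + dv e by abel]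
        field_simp
      rw [Finset.sum_congr rfl fun e' _ => this e', ← Finset.sum_div, ← Finset.sum_div]
      have h2 := hxe e
      unfold avg at h2
      rw [h2, ww, div_self (by positivity)]
      ring
    have h2 : ∀ e, ∑ e', ww f e' x / (2 * d) * (ww f e (x + dv e') - ww f e x) ^ 2 =
        ∑ e', ww f e' x / (2 * d) * ((ww f e (x + dv e') - 1) ^ 2 - (ww f e x - 1) ^ 2) := by
      intro e
      have : ∑ e', ww f e' x / (2 * d) * ((ww f e (x + dv e') - 1) ^ 2 - (ww f e x - 1) ^ 2) =
        ∑ e', ww f e' x / (2 * d) * (ww f e (x + dv e') - ww f e x) ^ 2 +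
         (2 * (ww f e x - 1)) * ∑ e', ww f e' x / (2 * d) * (ww f e (x + dv e') - ww f e x) := by
        rw [Finset.mul_sum, ← Finset.sum_add_distrib]
        refine Finset.sum_congr rfl fun e' _ => by ring
      rw [this, h1]; ring
    rw [Finset.sum_congr rfl fun e _ => h2 e, Finset.sum_comm]
    refine Finset.sum_congr rfl fun e' _ => ?_
    rw [← Finset.mul_sum, Finset.sum_sub_distrib]; rfl
  rw [key]
  have h3 : ∀ e, (1 - ww f e x * ww f (fl e) x) ^ 2 / (4 * d ^ 2) ≤
      ∑ e', ww f e' x / (2 * d) * (ww f e (x + dv e') - ww f e x) ^ 2 := by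
    intro e
    have h4 : ww f (fl e) x / (2 * d) * (ww f e (x + dv (fl e)) - ww f e x) ^ 2 ≤
       ∑ e', ww f e' x / (2 * d) * (ww f e (x + dv e') - ww f e x) ^ 2 :=
      Finset.single_le_sum (f := fun e' => ww f e' x / (2 * d) * (ww f e (x + dv e') - ww f e x) ^ 2)
       (fun e' _ => mul_nonneg (div_nonneg (ww_pos f hf x e').le (by positivity)) (sq_nonneg _)) (Finset.mem_univ _)
    refine le_trans ?_ h4
    have h5 : ww f e (x + dv (fl e)) = (ww f (fl e) x)⁻¹ := by
      unfold ww
      rw [dv_fl]; simp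
    rw [h5]
    have hp := ww_pos f hf x (fl e)
    have hl := ww_le hd f x hf hx (fl e)
    set v := ww f (fl e) x
    set u := ww f e x
    have : v / (2 * d) * (v⁻¹ - u) ^ 2 = (1 - u * v) ^ 2 / (2 * d * v) := by
      field_simp
    rw [this]
    apply div_le_div_of_nonneg_left (sq_nonneg _) (by positivity)
    nlinarith
  refine le_trans ?_ (Finset.sum_le_sum fun e _ => h3 e)
  have h6 := alg (fun e => ww f e x) (fun e => (ww_pos f hf x e).le) (sum_ww hd f x (hf x) hx)
  have h7 : ∑ e, (1 - ww f e x * ww f (fl e) x) ^ 2 / (4 * (d:ℝ) ^ 2) =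
      (∑ i, (1 - ww f (i, true) x * ww f (i, false) x) ^ 2) / (2 * (d:ℝ) ^ 2) := by
    rw [Fintype.sum_prod_type, Finset.sum_div]
    refine Finset.sum_congr rfl fun i _ => ?_
    simp [fl]; field_simp; ring
  rw [h7, div_le_div_iff₀ (by positivity) (by positivity)]
  unfold QQ
  calc _ ≤ ((2 + 8 * (d:ℝ)) ^ 2 * d *
      ∑ i, (1 - ww f (i, true) x * ww f (i, false) x) ^ 2) * (2 * d ^ 2) := by gcongr
    _ = _ := by ring

end Sol

namespace Sol

lemma abs_hh_le {d : ℕ} (z : Zd d) (R : ℝ) (hR : 1 ≤ R) (hz : nsq z ≤ R ^ 2) (e) : |hh z e| ≤ 3 * R := by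
  have h1 := sq_le_nsq z e.1
  have h2 : |(z e.1 : ℝ)| ≤ R := abs_le_of_sq_le_sq (h1.trans hz) (by linarith)
  rw [abs_le] at h2 ⊢
  unfold hh
  split_ifs <;> constructor <;> linarith

lemma inv_bound (u h : ℝ) (hu : 0 < u) (hh : |h| ≤ u / 2) :
    1 / (u - h) ^ 2 - 1 / u ^ 2 ≤ (1 / u ^ 2) * (2 * (h / u) + 8 * (h / u) ^ 2) := by
  rw [abs_le] at hh
  set t := h / u with ht
  have h1 : h = t * u := by rw [ht]; field_simp
  have ht1 : t ≤ 1 / 2 := by rw [ht, div_le_iff₀ hu]; linarith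
  have ht2 : -(1 / 2) ≤ t := by rw [ht, le_div_iff₀ hu]; linarith
  have hp : 0 < 1 - t := by linarith
  have e1 : 1 / (u - h) ^ 2 = (1 / u ^ 2) * (1 / (1 - t) ^ 2) := by
    rw [h1, show u - t * u = u * (1 - t) by ring]; field_simp
  have e2 : 1 / (1 - t) ^ 2 ≤ 1 + (2 * t + 8 * t ^ 2) := by
    rw [div_le_iff₀ (by positivity)]
    have : 0 ≤ t ^ 2 * ((1 - 2 * t) * (5 - 4 * t)) := by
      apply mul_nonneg (sq_nonneg _) (mul_nonneg _ _) <;> linarith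
    nlinarith
  rw [e1]
  have : 0 < 1 / u ^ 2 := by positivity
  nlinarith

lemma finite_nsq {d : ℕ} (R : ℕ) : {z : Zd d | nsq z ≤ (R:ℝ) ^ 2}.Finite := by
  apply (Set.finite_Icc (fun _ => -(R:ℤ) : Zd d) (fun _ => (R:ℤ))).subset
  intro z hz
  have : ∀ i, -(R:ℤ) ≤ z i ∧ z i ≤ R := by
    intro i
    have h2 : |(z i : ℝ)| ≤ R := abs_le_of_sq_le_sq ((sq_le_nsq z i).trans hz) (by positivity)
    rw [abs_le] at h2
    constructor
    · exact_mod_cast h2.1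
    · exact_mod_cast h2.2
  exact ⟨fun i => (this i).1, fun i => (this i).2⟩

lemma QQ_le {d : ℕ} (hd : 1 ≤ d) (f : Zd d → ℝ) (x : Zd d) (hf : ∀ z, 0 < f z)
    (hx : avg f x = f x) : QQ f x ≤ 8 * d ^ 3 := by
  have hdp : (1:ℝ) ≤ d := by exact_mod_cast hd
  unfold QQ
  calc _ ≤ ∑ e : Fin d × Bool, (2 * (d:ℝ)) ^ 2 := by
        refine Finset.sum_le_sum fun e _ => ?_
        have := ww_le hd f x hf hx e
        have := ww_pos f hf x e
        apply sq_le_sq' <;> linarith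
    _ = _ := by simp; ring

lemma grad0 {d : ℕ} (hd : 1 ≤ d) : ∃ C : ℝ, 0 < C ∧ ∀ (R : ℕ), 1 ≤ R → ∀ f : Zd d → ℝ,
    (∀ z, 0 < f z) → (∀ z : Zd d, (∀ i, |z i| ≤ R + 1) → avg f z = f z) →
    QQ f 0 * R ^ 2 ≤ C := by
  have hdp : (1:ℝ) ≤ d := by exact_mod_cast hd
  obtain ⟨c, hc⟩ : ∃ c : ℝ, c = 1 / (2 * d ^ 3 * (2 + 8 * d) ^ 2) := ⟨_, rfl⟩
  have hcp : 0 < c := by rw [hc]; positivity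
  refine ⟨36 * (8 * d ^ 3) + 2 / c * (74 + 9 / (c * d)), by positivity, ?_⟩
  intro R hR f hf hharm
  have hRp : (1:ℝ) ≤ R := by exact_mod_cast hR
  obtain ⟨x, hxD, hmax⟩ := Set.exists_max_image {z : Zd d | nsq z ≤ (R:ℝ) ^ 2}
    (fun z => ((R:ℝ) ^ 2 - nsq z) ^ 2 * QQ f z) (finite_nsq R) ⟨0, by simp [nsq]⟩
  have hxD' : nsq x ≤ (R:ℝ) ^ 2 := hxD
  have hcoord : ∀ i, |x i| ≤ R := by
    intro i
    have h2 : |(x i : ℝ)| ≤ R := abs_le_of_sq_le_sq ((sq_le_nsq x i).trans hxD) (by positivity)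
    exact_mod_cast h2
  have hx : avg f x = f x := hharm x fun i => (hcoord i).trans (by linarith)
  have hxe : ∀ e, avg f (x + dv e) = f (x + dv e) := by
    intro e
    apply hharm
    intro i
    have h1 : |dv e i| ≤ 1 := by
      unfold dv
      by_cases h : i = e.1
      · rw [h]; cases e.2 <;> simp
      · simp [h]
    calc |(x + dv e) i| ≤ |x i| + |dv e i| := abs_add_le _ _
      _ ≤ _ := add_le_add (hcoord i) h1
  have h0 : (R:ℝ) ^ 4 * QQ f 0 ≤ ((R:ℝ) ^ 2 - nsq x) ^ 2 * QQ f x := by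
    have := hmax 0 (by simp [nsq])
    have h0 : nsq (0 : Zd d) = 0 := by simp [nsq]
    simp only [h0] at this
    calc _ = ((R:ℝ) ^ 2 - 0) ^ 2 * QQ f 0 := by ring
      _ ≤ _ := this
  have hQ0 : ∀ z, 0 ≤ QQ f z := fun z => Finset.sum_nonneg fun _ _ => sq_nonneg _
  set u := (R:ℝ) ^ 2 - nsq x with hu
  have hu0 : 0 ≤ u := by rw [hu]; linarith
  have huR : u ≤ (R:ℝ) ^ 2 := by have := nsq_nonneg x; rw [hu]; linarith
  suffices hM : u ^ 2 * QQ f x ≤ (36 * (8 * d ^ 3) + 2 / c * (74 + 9 / (c * d))) * R ^ 2 by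
    have h2 : (R:ℝ) ^ 2 * (QQ f 0 * R ^ 2) ≤ R ^ 2 * (36 * (8 * d ^ 3) + 2 / c * (74 + 9 / (c * d))) := by
      calc _ = (R:ℝ) ^ 4 * QQ f 0 := by ring
        _ ≤ _ := h0.trans hM
        _ = _ := by ring
    exact le_of_mul_le_mul_left h2 (by positivity)
  rcases lt_or_ge u (6 * R) with h | h
  · have h3 := QQ_le hd f x hf hx
    have h4 : u ^ 2 ≤ 36 * (R:ℝ) ^ 2 := by nlinarith
    calc u ^ 2 * QQ f x ≤ (36 * (R:ℝ) ^ 2) * (8 * (d:ℝ) ^ 3) := by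
          apply mul_le_mul h4 h3 (hQ0 _) (by positivity)
      _ = (36 * (8 * (d:ℝ) ^ 3)) * (R:ℝ) ^ 2 := by ring
      _ ≤ _ := by
          apply mul_le_mul_of_nonneg_right _ (by positivity)
          have : 0 ≤ 2 / c * (74 + 9 / (c * d)) := by positivity
          linarith
  · have hup : 0 < u := by linarith
    have hQx := hQ0 x
    rcases hQx.eq_or_lt with hz | hQp
    · rw [← hz]; simp; positivity
    have hb := bochner hd f x hf hx hxe
    have habs := fun e => abs_hh_le x R hRp hxD' e
    have hnb : ∀ e, QQ f (x + dv e) - QQ f x ≤ QQ f x * (2 * (hh x e / u) + 8 * (hh x e / u) ^ 2) := by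
      intro e
      have hle : |hh x e| ≤ u / 2 := (habs e).trans (by linarith)
      have hpos : 0 < u - hh x e := by have := (abs_le.mp hle).2; linarith
      have h5 := hmax (x + dv e) (by
        show nsq (x + dv e) ≤ _
        rw [nsq_add]; linarith)
      simp only [nsq_add] at h5
      rw [show (R:ℝ) ^ 2 - (nsq x + hh x e) = u - hh x e by rw [hu]; ring] at h5
      have h6 : QQ f (x + dv e) ≤ u ^ 2 * QQ f x * (1 / (u - hh x e) ^ 2) := by
        rw [mul_one_div, le_div_iff₀ (by positivity)]; linarith
      have h7 := inv_bound u (hh x e) hup hle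
      have h8 : QQ f x = u ^ 2 * QQ f x * (1 / u ^ 2) := by field_simp
      have h9 := mul_le_mul_of_nonneg_left h7 (show 0 ≤ u ^ 2 * QQ f x by positivity)
      calc _ ≤ u ^ 2 * QQ f x * (1 / (u - hh x e) ^ 2) - u ^ 2 * QQ f x * (1 / u ^ 2) := by linarith
        _ = u ^ 2 * QQ f x * (1 / (u - hh x e) ^ 2 - 1 / u ^ 2) := by ring
        _ ≤ _ := h9
        _ = _ := by field_simp
    have h10 : QQ f x * (c * QQ f x) ≤ QQ f x * ∑ e, ww f e x / (2 * d) * (2 * (hh x e / u) + 8 * (hh x e / u) ^ 2) := by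
      calc _ = QQ f x ^ 2 / (2 * d ^ 3 * (2 + 8 * d) ^ 2) := by rw [hc]; ring
        _ ≤ _ := hb
        _ ≤ ∑ e, ww f e x / (2 * d) * (QQ f x * (2 * (hh x e / u) + 8 * (hh x e / u) ^ 2)) := by
            refine Finset.sum_le_sum fun e _ => mul_le_mul_of_nonneg_left (hnb e) ?_
            exact div_nonneg (ww_pos f hf x e).le (by positivity)
        _ = _ := by rw [Finset.mul_sum]; refine Finset.sum_congr rfl fun e _ => by ring
    have h11 := le_of_mul_le_mul_left h10 hQp
    -- termwise bound
    have h12 : ∀ e, u ^ 2 * (ww f e x / (2 * d) * (2 * (hh x e / u) + 8 * (hh x e / u) ^ 2)) ≤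
        u / d * hh x e + (c / 2 * u ^ 2 * (ww f e x - 1) ^ 2 + 9 * R ^ 2 / (2 * c * d ^ 2)) + 72 * R ^ 2 * (ww f e x / (2 * d)) := by
      intro e
      have hw := ww_pos f hf x e
      have hq : hh x e ^ 2 ≤ 9 * R ^ 2 := by
        have := habs e
        rw [← sq_abs]; nlinarith [abs_nonneg (hh x e)]
      have e1 : u ^ 2 * (ww f e x / (2 * d) * (2 * (hh x e / u) + 8 * (hh x e / u) ^ 2)) =
         u / d * hh x e + (u * (ww f e x - 1)) * (hh x e / d) + 8 * hh x e ^ 2 * (ww f e x / (2 * d)) := by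
        field_simp; ring
      rw [e1]
      have e2 : (u * (ww f e x - 1)) * (hh x e / d) ≤ c / 2 * u ^ 2 * (ww f e x - 1) ^ 2 + 9 * R ^ 2 / (2 * c * d ^ 2) := by
        have e3 : (u * (ww f e x - 1)) * (hh x e / d) ≤ c / 2 * (u * (ww f e x - 1)) ^ 2 + (hh x e / d) ^ 2 / (2 * c) := by
          have : 0 ≤ (c * (u * (ww f e x - 1)) - hh x e / d) ^ 2 / (2 * c) := by positivity
          have e4 : (c * (u * (ww f e x - 1)) - hh x e / d) ^ 2 / (2 * c) =
            c / 2 * (u * (ww f e x - 1)) ^ 2 + (hh x e / d) ^ 2 / (2 * c) - (u * (ww f e x - 1)) * (hh x e / d) := by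
            field_simp; ring
          linarith
        have e5 : (hh x e / d) ^ 2 / (2 * c) ≤ 9 * R ^ 2 / (2 * c * d ^ 2) := by
          rw [div_pow, div_div, mul_comm ((d:ℝ) ^ 2)]
          gcongr
        nlinarith
      have e6 : 8 * hh x e ^ 2 * (ww f e x / (2 * d)) ≤ 72 * R ^ 2 * (ww f e x / (2 * d)) := by
        apply mul_le_mul_of_nonneg_right _ (by positivity); linarith
      linarith
    have h13 : u ^ 2 * (c * QQ f x) ≤ 2 * u + (c / 2 * u ^ 2 * QQ f x + 9 * R ^ 2 / (c * d)) + 72 * R ^ 2 := by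
      calc _ ≤ u ^ 2 * ∑ e, ww f e x / (2 * d) * (2 * (hh x e / u) + 8 * (hh x e / u) ^ 2) := by gcongr
        _ ≤ ∑ e, (u / d * hh x e + (c / 2 * u ^ 2 * (ww f e x - 1) ^ 2 + 9 * R ^ 2 / (2 * c * d ^ 2)) + 72 * R ^ 2 * (ww f e x / (2 * d))) := by
          rw [Finset.mul_sum]; exact Finset.sum_le_sum fun e _ => h12 e
        _ = _ := by
          rw [Finset.sum_add_distrib, Finset.sum_add_distrib, Finset.sum_add_distrib, ← Finset.mul_sum, ← Finset.mul_sum, ← Finset.mul_sum, ← Finset.sum_div, ← Finset.sum_div, sum_hh, sum_ww hd f x (hf x) hx]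
          simp [QQ]
          field_simp
    have h14 : c / 2 * (u ^ 2 * QQ f x) ≤ (74 + 9 / (c * d)) * R ^ 2 := by
      have : 9 * (R:ℝ) ^ 2 / (c * d) = 9 / (c * d) * R ^ 2 := by ring
      rw [this] at h13
      nlinarith
    have h15 : u ^ 2 * QQ f x ≤ 2 / c * ((74 + 9 / (c * d)) * R ^ 2) := by
      have := mul_le_mul_of_nonneg_left h14 (show 0 ≤ 2 / c by positivity)
      have e : 2 / c * (c / 2 * (u ^ 2 * QQ f x)) = u ^ 2 * QQ f x := by field_simp
      linarith
    refine h15.trans ?_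
    have h16 : 0 ≤ 36 * (8 * (d:ℝ) ^ 3) * (R:ℝ) ^ 2 := by positivity
    have e2 : (36 * (8 * (d:ℝ) ^ 3) + 2 / c * (74 + 9 / (c * d))) * (R:ℝ) ^ 2 = 36 * (8 * (d:ℝ) ^ 3) * (R:ℝ) ^ 2 + 2 / c * ((74 + 9 / (c * d)) * (R:ℝ) ^ 2) := by ring
    rw [e2]
    linarith

/-- gradient bound for nonnegative harmonic functions -/
lemma grad {d : ℕ} (hd : 1 ≤ d) : ∃ C : ℝ, 0 < C ∧ ∀ (R : ℕ), 1 ≤ R → ∀ (f : Zd d → ℝ) (z₀ : Zd d),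
    (∀ z, 0 ≤ f z) → (∀ z : Zd d, (∀ i, |z i| ≤ R + 1) → avg f (z₀ + z) = f (z₀ + z)) →
    ∀ e, f (z₀ + dv e) ≤ (1 + C / R) * f z₀ := by
  obtain ⟨C, hC, h⟩ := grad0 (d := d) hd
  refine ⟨Real.sqrt C, Real.sqrt_pos.mpr hC, ?_⟩
  intro R hR f z₀ hf hharm e
  have hRp : (0:ℝ) < R := by exact_mod_cast hR
  have hdp : (0:ℝ) < d := by exact_mod_cast hd
  apply _root_.le_of_forall_pos_le_add
  intro ε hε
  set η := ε / (1 + Real.sqrt C / R) with hη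
  have h1p : 0 < 1 + Real.sqrt C / R := by positivity
  have hηp : 0 < η := by positivity
  have hg0 : ∀ z, 0 < f (z₀ + z) + η := fun z => by have := hf (z₀ + z); linarith
  have := h R hR (fun z => f (z₀ + z) + η) hg0 (by
    intro z hz
    have h2 := hharm z hz
    unfold avg at h2 ⊢
    simp only [Finset.sum_add_distrib, add_div, add_assoc] at h2 ⊢
    rw [h2]
    simp
    field_simp)
  have h3 : (ww (fun z => f (z₀ + z) + η) e 0 - 1) ^ 2 ≤ QQ (fun z => f (z₀ + z) + η) 0 :=
    Finset.single_le_sum (f := fun e => (ww (fun z => f (z₀ + z) + η) e 0 - 1) ^ 2) (fun _ _ => sq_nonneg _) (Finset.mem_univ e)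
  have h4 : (ww (fun z => f (z₀ + z) + η) e 0 - 1) * R ≤ Real.sqrt C := by
    apply Real.le_sqrt_of_sq_le
    rw [mul_pow]
    exact (mul_le_mul_of_nonneg_right h3 (by positivity)).trans this
  have h5 : ww (fun z => f (z₀ + z) + η) e 0 ≤ 1 + Real.sqrt C / R := by
    rw [← le_div_iff₀ hRp] at h4; linarith
  unfold ww at h5
  simp only [zero_add, add_zero] at h5
  have h6 := hg0 0
  rw [add_zero] at h6
  rw [div_le_iff₀ h6] at h5
  have : (1 + Real.sqrt C / R) * η = ε := by rw [hη]; field_simp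
  nlinarith

end Sol

namespace Sol

lemma avg_mono {d : ℕ} {f g : Zd d → ℝ} (z : Zd d) (h : ∀ e, f (z + dv e) ≤ g (z + dv e)) : avg f z ≤ avg g z := by
  unfold avg
  exact div_le_div_of_nonneg_right (Finset.sum_le_sum fun e _ => h e) (by positivity)

lemma avg_nonneg {d : ℕ} {g : Zd d → ℝ} (h : ∀ z, 0 ≤ g z) (z : Zd d) : 0 ≤ avg g z :=
  div_nonneg (Finset.sum_nonneg fun _ _ => h _) (by positivity)

lemma avg_const {d : ℕ} (hd : 1 ≤ d) (c : ℝ) (z : Zd d) : avg (fun _ => c) z = c := by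
  have : (0:ℝ) < d := by exact_mod_cast hd
  simp [avg]; field_simp

lemma avg_sub {d : ℕ} (f g : Zd d → ℝ) (z : Zd d) : avg (fun v => f v - g v) z = avg f z - avg g z := by
  simp [avg, Finset.sum_sub_distrib, sub_div]

lemma avg_add {d : ℕ} (f g : Zd d → ℝ) (z : Zd d) : avg (fun v => f v + g v) z = avg f z + avg g z := by
  simp [avg, Finset.sum_add_distrib, add_div]

lemma avg_mul {d : ℕ} (c : ℝ) (g : Zd d → ℝ) (z : Zd d) : avg (fun v => c * g v) z = c * avg g z := by
  simp [avg, ← Finset.mul_sum, mul_div_assoc]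

lemma avg_tendsto {d : ℕ} {f : ℕ → Zd d → ℝ} {g : Zd d → ℝ}
    (h : ∀ v, Filter.Tendsto (fun n => f n v) Filter.atTop (nhds (g v))) (z : Zd d) :
    Filter.Tendsto (fun n => avg (f n) z) Filter.atTop (nhds (avg g z)) :=
  (tendsto_finsetSum _ fun e _ => h _).div_const _

noncomputable def uu {d : ℕ} (z : Zd d) : ℝ := (10000 + nsq z) ^ (-(1/4) : ℝ)

lemma uu_pos {d : ℕ} (z : Zd d) : 0 < uu z :=
  Real.rpow_pos_of_pos (by have := nsq_nonneg z; linarith) _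

lemma rpow_poly (w : ℝ) (hw : |w| ≤ 1 / 40) : (1 + w) ^ (-(1/4) : ℝ) ≤ 1 - w / 4 + 11 / 64 * w ^ 2 := by
  rw [abs_le] at hw
  obtain ⟨h1, h2⟩ := hw
  have hp : 0 < 1 - w / 4 + 11 / 64 * w ^ 2 := by nlinarith [sq_nonneg w]
  have h1w : 0 < 1 + w := by linarith
  have key : 1 ≤ (1 + w) * (1 - w / 4 + 11 / 64 * w ^ 2) ^ 4 := by
    have e : (1 + w) * (1 - w / 4 + 11 / 64 * w ^ 2) ^ 4 - 1 = w ^ 2 * (1/16 + w * ((31/64) * w ^ 0 + (-549/2048) * w ^ 1 + (863/4096) * w ^ 2 + (-4455/65536) * w ^ 3 + (6897/262144) * w ^ 4 + (-70543/16777216) * w ^ 5 + (14641/16777216) * w ^ 6)) := by ring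
    have hb : |(31/64) * w ^ 0 + (-549/2048) * w ^ 1 + (863/4096) * w ^ 2 + (-4455/65536) * w ^ 3 + (6897/262144) * w ^ 4 + (-70543/16777216) * w ^ 5 + (14641/16777216) * w ^ 6| ≤ 2 := by
      have hp2 : |w| ≤ 1 := by rw [abs_le]; constructor <;> linarith
      have hpow : ∀ k : ℕ, -1 ≤ w ^ k ∧ w ^ k ≤ 1 := fun k => abs_le.mp (by rw [abs_pow]; exact pow_le_one₀ (abs_nonneg w) hp2)
      have := hpow 0; have := hpow 1; have := hpow 2; have := hpow 3
      have := hpow 4; have := hpow 5; have := hpow 6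
      rw [abs_le]
      constructor <;> linarith
    rw [abs_le] at hb
    have : 0 ≤ w ^ 2 * (1/16 + w * ((31/64) * w ^ 0 + (-549/2048) * w ^ 1 + (863/4096) * w ^ 2 + (-4455/65536) * w ^ 3 + (6897/262144) * w ^ 4 + (-70543/16777216) * w ^ 5 + (14641/16777216) * w ^ 6)) := by
      apply mul_nonneg (sq_nonneg w)
      nlinarith
    linarith
  have h3 : (1 + w)⁻¹ ≤ (1 - w / 4 + 11 / 64 * w ^ 2) ^ 4 := by
    rw [inv_le_iff_one_le_mul₀ h1w]; linarith
  rw [Real.rpow_neg h1w.le, ← Real.inv_rpow h1w.le]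
  calc _ ≤ ((1 - w / 4 + 11 / 64 * w ^ 2) ^ 4) ^ (1/4 : ℝ) :=
        Real.rpow_le_rpow (by positivity) h3 (by norm_num)
    _ = _ := by
        rw [← Real.rpow_natCast, ← Real.rpow_mul hp.le]; norm_num

lemma uu_super {d : ℕ} (hd : 3 ≤ d) (z : Zd d) : avg uu z < uu z := by
  have hdp : (3:ℝ) ≤ d := by exact_mod_cast hd
  have hn := nsq_nonneg z
  obtain ⟨s, hs⟩ : ∃ s, s = 10000 + nsq z := ⟨_, rfl⟩
  have hsp : 0 < s := by linarith
  have hU : uu z = s ^ (-(1/4) : ℝ) := by rw [hs]; rfl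
  have h1 : ∀ e, uu (z + dv e) ≤ uu z * (1 - (hh z e / s) / 4 + 11 / 64 * (hh z e / s) ^ 2) := by
    intro e
    have hle : |hh z e / s| ≤ 1 / 40 := by
      rw [abs_div, abs_of_pos hsp, div_le_iff₀ hsp]
      have h1 := sq_le_nsq z e.1
      rw [abs_le]
      unfold hh
      split_ifs <;> constructor <;> nlinarith [sq_nonneg ((z e.1 : ℝ) - 40), sq_nonneg ((z e.1 : ℝ) + 40)]
    have h2 := rpow_poly _ hle
    rw [abs_le] at hle
    have h3 : uu (z + dv e) = uu z * (1 + hh z e / s) ^ (-(1/4) : ℝ) := by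
      rw [hU, ← Real.mul_rpow hsp.le (by linarith)]
      unfold uu
      rw [nsq_add]
      congr 1
      field_simp
      rw [hs]; ring
    rw [h3]
    exact mul_le_mul_of_nonneg_left h2 (uu_pos z).le
  have h2 : ∑ e : Fin d × Bool, (1 - (hh z e / s) / 4 + 11 / 64 * (hh z e / s) ^ 2) < 2 * (d:ℝ) := by
    simp only [Finset.sum_add_distrib, Finset.sum_sub_distrib, ← Finset.mul_sum, ← Finset.sum_div, div_pow, sum_hh, sum_hh_sq]
    have : 2 * (d:ℝ) - 2 * d / s / 4 + 11 / 64 * ((8 * nsq z + 2 * d) / s ^ 2) = 2 * d - (2 * d * s / 4 - 11 / 64 * (8 * nsq z + 2 * d)) / s ^ 2 := by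
      field_simp
      ring
    have h3 : 0 < (2 * (d:ℝ) * s / 4 - 11 / 64 * (8 * nsq z + 2 * d)) / s ^ 2 := by
      apply div_pos _ (by positivity)
      rw [hs]
      nlinarith
    simp
    have e4 : (d:ℝ) * 2 = 2 * d := by ring
    rw [e4, this]
    linarith
  unfold avg
  rw [div_lt_iff₀ (by positivity)]
  calc _ ≤ _ := Finset.sum_le_sum fun e _ => h1 e
    _ = uu z * _ := by rw [← Finset.mul_sum]
    _ < _ := mul_lt_mul_of_pos_left h2 (uu_pos z)

def inb {d : ℕ} (n : ℕ) (z : Zd d) : Prop := ∀ i, |z i| ≤ n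

lemma lyap {d : ℕ} (ε : ℝ) (hε : 0 < ε) : ∃ r : ℕ, 1 ≤ r ∧ ∀ L : ℕ, 1 ≤ L → ∃ m : ℝ, 0 < m ∧
    (∀ a : Zd d, inb L a → m ≤ uu a) ∧ ∀ z : Zd d, ¬ inb (r * L) z → uu z ≤ ε * m := by
  obtain ⟨r, hr⟩ := exists_nat_gt ((10000 + d) / ε ^ 4)
  have hrp : (0:ℝ) < r := lt_of_le_of_lt (by positivity) hr
  have hr1 : 1 ≤ r := by exact_mod_cast hrp
  refine ⟨r, hr1, ?_⟩
  intro L hL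
  have hLp : (1:ℝ) ≤ L := by exact_mod_cast hL
  refine ⟨(10000 + d * (L:ℝ) ^ 2) ^ (-(1/4) : ℝ), Real.rpow_pos_of_pos (by positivity) _, ?_, ?_⟩
  · intro a ha
    unfold uu
    have := nsq_nonneg a
    apply Real.rpow_le_rpow_of_nonpos (by linarith) _ (by norm_num)
    have : nsq a ≤ ∑ i : Fin d, (L:ℝ) ^ 2 := by
      refine Finset.sum_le_sum fun i _ => ?_
      have := ha i
      have h2 : |(a i : ℝ)| ≤ L := by exact_mod_cast this
      rw [← sq_abs]
      gcongr
    simp at this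
    linarith
  · intro z hz
    unfold inb at hz
    push Not at hz
    obtain ⟨i, hi⟩ := hz
    have h1 : ((r:ℝ) * L) ^ 2 ≤ nsq z := by
      refine le_trans ?_ (sq_le_nsq z i)
      rw [← sq_abs (z i : ℝ)]
      have h2 : ((r * L : ℕ) : ℝ) < |(z i : ℝ)| := by exact_mod_cast hi
      push_cast at h2
      gcongr
    have h2 : 10000 + d * (L:ℝ) ^ 2 ≤ ε ^ 4 * (10000 + nsq z) := by
      rw [div_lt_iff₀ (by positivity)] at hr
      have hr1' : (1:ℝ) ≤ r := by exact_mod_cast hr1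
      have h3 : (10000 + d : ℝ) ≤ r ^ 2 * ε ^ 4 := by
        have : (r:ℝ) ≤ r ^ 2 := by nlinarith
        have : (r:ℝ) * ε ^ 4 ≤ r ^ 2 * ε ^ 4 := by gcongr
        linarith
      have hL2 : (1:ℝ) ≤ (L:ℝ) ^ 2 := by nlinarith
      calc 10000 + d * (L:ℝ) ^ 2 ≤ (10000 + d) * (L:ℝ) ^ 2 := by nlinarith
        _ ≤ r ^ 2 * ε ^ 4 * (L:ℝ) ^ 2 := by gcongr
        _ = ε ^ 4 * (((r:ℝ) * L) ^ 2) := by ring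
        _ ≤ ε ^ 4 * (10000 + nsq z) := by gcongr; linarith
    have hn := nsq_nonneg z
    have h3 := Real.rpow_le_rpow_of_nonpos (z := (-(1/4) : ℝ)) (by positivity) h2 (by norm_num)
    rw [Real.mul_rpow (by positivity) (by linarith)] at h3
    have h4 : (ε ^ 4) ^ (-(1/4) : ℝ) = ε⁻¹ := by
      rw [← Real.rpow_natCast, ← Real.rpow_mul hε.le]; norm_num [Real.rpow_neg_one]
    rw [h4] at h3
    change ε⁻¹ * uu z ≤ _ at h3
    rwa [inv_mul_le_iff₀ hε] at h3

noncomputable def dlt {d : ℕ} (x v : Zd d) : ℝ := if v = x then 1 else 0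

noncomputable def bn {d : ℕ} (B : Set (Zd d)) (x : Zd d) : ℕ → Zd d → ℝ
  | 0 => dlt x
  | n + 1 => fun v => if v ∈ B then 0 else avg (bn B x n) v

lemma dlt_nonneg {d : ℕ} (x v : Zd d) : 0 ≤ dlt x v := by unfold dlt; split_ifs <;> norm_num

lemma bn_nonneg {d : ℕ} (B : Set (Zd d)) (x : Zd d) (n : ℕ) : ∀ v, 0 ≤ bn B x n v := by
  induction n with
  | zero => exact dlt_nonneg x
  | succ n ih =>
    intro v
    simp only [bn]
    split_ifs
    · exact le_rfl
    · exact avg_nonneg ih v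

noncomputable def gs {d : ℕ} (B : Set (Zd d)) (x : Zd d) (N : ℕ) (v : Zd d) : ℝ :=
  ∑ n ∈ Finset.range N, bn B x n v

lemma gs_rec {d : ℕ} (B : Set (Zd d)) (x : Zd d) (N : ℕ) (v : Zd d) :
    gs B x (N + 1) v = dlt x v + if v ∈ B then 0 else avg (gs B x N) v := by
  unfold gs
  rw [Finset.sum_range_succ']
  rw [add_comm]
  congr 1
  simp only [bn]
  split_ifs
  · simp
  · unfold avg
    rw [← Finset.sum_div, Finset.sum_comm]

lemma gs_nonneg {d : ℕ} (B : Set (Zd d)) (x : Zd d) (N : ℕ) (v : Zd d) : 0 ≤ gs B x N v :=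
  Finset.sum_nonneg fun _ _ => bn_nonneg _ _ _ _

lemma gs_le {d : ℕ} (hd : 3 ≤ d) (B : Set (Zd d)) (x : Zd d) (N : ℕ) : ∀ v,
    gs B x N v ≤ (uu x - avg uu x)⁻¹ * uu v := by
  have hg : 0 < uu x - avg uu x := by have := uu_super hd x; linarith
  induction N with
  | zero => intro v; simp [gs]; have := uu_pos v; positivity
  | succ N ih =>
    intro v
    rw [gs_rec]
    have h1 : (if v ∈ B then 0 else avg (gs B x N) v) ≤ (uu x - avg uu x)⁻¹ * avg uu v := by
      split_ifs
      · have : 0 ≤ avg uu v := avg_nonneg (fun z => (uu_pos z).le) v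
        positivity
      · rw [← avg_mul]; exact avg_mono v fun e => ih _
    have h2 : dlt x v ≤ (uu x - avg uu x)⁻¹ * (uu v - avg uu v) := by
      unfold dlt
      split_ifs with h
      · rw [h, inv_mul_cancel₀ hg.ne']
      · have := uu_super hd v
        exact mul_nonneg (by positivity) (by linarith)
    calc _ ≤ _ := add_le_add h2 h1
      _ = _ := by ring

noncomputable def gg {d : ℕ} (B : Set (Zd d)) (x v : Zd d) : ℝ := ∑' n, bn B x n v

lemma bn_summable {d : ℕ} (hd : 3 ≤ d) (B : Set (Zd d)) (x v : Zd d) : Summable fun n => bn B x n v :=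
  summable_of_sum_range_le (fun n => bn_nonneg B x n v) (fun N => gs_le hd B x N v)

lemma gs_tendsto {d : ℕ} (hd : 3 ≤ d) (B : Set (Zd d)) (x v : Zd d) :
    Filter.Tendsto (fun N => gs B x N v) Filter.atTop (nhds (gg B x v)) :=
  (bn_summable hd B x v).hasSum.tendsto_sum_nat

lemma gs_le_gg {d : ℕ} (hd : 3 ≤ d) (B : Set (Zd d)) (x : Zd d) (N : ℕ) (v : Zd d) : gs B x N v ≤ gg B x v :=
  (bn_summable hd B x v).sum_le_tsum _ (fun n _ => bn_nonneg B x n v)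

lemma gg_nonneg {d : ℕ} (B : Set (Zd d)) (x v : Zd d) : 0 ≤ gg B x v := tsum_nonneg fun n => bn_nonneg B x n v

lemma gg_rec {d : ℕ} (hd : 3 ≤ d) (B : Set (Zd d)) (x v : Zd d) :
    gg B x v = dlt x v + if v ∈ B then 0 else avg (gg B x) v := by
  have h1 := (gs_tendsto hd B x v).comp (Filter.tendsto_add_atTop_nat 1)
  refine tendsto_nhds_unique h1 ?_
  have : (fun N => gs B x N v) ∘ (fun a => a + 1) = fun N => dlt x v + if v ∈ B then 0 else avg (gs B x N) v := by
    ext N; exact gs_rec B x N v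
  rw [this]
  apply Filter.Tendsto.const_add
  split_ifs
  · exact tendsto_const_nhds
  · exact avg_tendsto (fun v => gs_tendsto hd B x v) v

lemma gs_compare {d : ℕ} (hd : 3 ≤ d) (B B' A : Set (Zd d)) (hB : B' ⊆ B) (hA : ∀ v ∈ B, v ∉ B' → v ∈ A) (x : Zd d)
    (C m : ℝ) (hm : 0 < m) (hC : 0 ≤ C) (hmA : ∀ a ∈ A, m ≤ uu a) (hCA : ∀ a ∈ A, gg B' x a ≤ C) (N : ℕ) :
    ∀ v, 0 ≤ gs B' x N v - gs B x N v ∧ gs B' x N v - gs B x N v ≤ C / m * uu v := by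
  induction N with
  | zero => intro v; simp [gs]; have := uu_pos v; positivity
  | succ N ih =>
    intro v
    have hu := uu_pos v
    by_cases h1 : v ∈ B
    · by_cases h2 : v ∈ B'
      · rw [gs_rec, gs_rec]; simp [h1, h2]; positivity
      · have hvA := hA v h1 h2
        constructor
        · rw [gs_rec, gs_rec]; simp only [h1, h2, if_true, if_false]
          have := avg_nonneg (gs_nonneg B' x N) v
          linarith
        · have h3 := gs_le_gg hd B' x (N+1) v
          have h4 := hCA v hvA
          have h5 := gs_nonneg B x (N+1) v
          have h6 : C ≤ C / m * uu v := by
            rw [div_mul_eq_mul_div, le_div_iff₀ hm]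
            exact mul_le_mul_of_nonneg_left (hmA v hvA) hC
          linarith
    · have h2 : v ∉ B' := fun h => h1 (hB h)
      rw [gs_rec, gs_rec]; simp only [h1, h2, if_false]
      have e : dlt x v + avg (gs B' x N) v - (dlt x v + avg (gs B x N) v) = avg (fun v => gs B' x N v - gs B x N v) v := by
        rw [avg_sub]; ring
      rw [e]
      refine ⟨avg_nonneg (fun v => (ih v).1) v, ?_⟩
      calc _ ≤ avg (fun v => C / m * uu v) v := avg_mono v fun e => (ih _).2
        _ = C / m * avg uu v := avg_mul _ _ _
        _ ≤ _ := mul_le_mul_of_nonneg_left (uu_super hd v).le (by positivity)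

lemma gg_compare {d : ℕ} (hd : 3 ≤ d) (B B' A : Set (Zd d)) (hB : B' ⊆ B) (hA : ∀ v ∈ B, v ∉ B' → v ∈ A) (x : Zd d)
    (C m : ℝ) (hm : 0 < m) (hC : 0 ≤ C) (hmA : ∀ a ∈ A, m ≤ uu a) (hCA : ∀ a ∈ A, gg B' x a ≤ C) (v : Zd d) :
    gg B x v ≤ gg B' x v ∧ gg B' x v - gg B x v ≤ C / m * uu v := by
  have h := (gs_tendsto hd B' x v).sub (gs_tendsto hd B x v)
  have h0 := gs_compare hd B B' A hB hA x C m hm hC hmA hCA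
  constructor
  · have := ge_of_tendsto' h fun N => (h0 N v).1
    linarith
  · exact le_of_tendsto' h fun N => (h0 N v).2

noncomputable def cn {d : ℕ} (A : Set (Zd d)) : ℕ → Zd d → ℝ
  | 0 => fun _ => 1
  | n + 1 => avg (fun v => if v ∈ A then 0 else cn A n v)

lemma cn_nonneg {d : ℕ} (A : Set (Zd d)) (n : ℕ) : ∀ v, 0 ≤ cn A n v := by
  induction n with
  | zero => intro v; simp [cn]
  | succ n ih =>
    intro v
    exact avg_nonneg (fun z => by split_ifs; exacts [le_rfl, ih z]) v

lemma cn_succ_le {d : ℕ} (hd : 1 ≤ d) (A : Set (Zd d)) (n : ℕ) : ∀ v, cn A (n + 1) v ≤ cn A n v := by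
  induction n with
  | zero =>
    intro v
    simp only [cn]
    conv_rhs => rw [← avg_const hd 1 v]
    exact avg_mono v fun e => by split_ifs <;> norm_num
  | succ n ih =>
    intro v
    exact avg_mono v fun e => by
      split_ifs
      · exact le_rfl
      · exact ih _

noncomputable def ce {d : ℕ} (A : Set (Zd d)) (v : Zd d) : ℝ := ⨅ n, cn A n v

lemma cn_tendsto {d : ℕ} (hd : 1 ≤ d) (A : Set (Zd d)) (v : Zd d) :
    Filter.Tendsto (fun n => cn A n v) Filter.atTop (nhds (ce A v)) :=
  tendsto_atTop_ciInf (antitone_nat_of_succ_le fun n => cn_succ_le hd A n v)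
    ⟨0, by rintro _ ⟨n, rfl⟩; exact cn_nonneg A n v⟩

lemma ce_le_one {d : ℕ} (hd : 1 ≤ d) (A : Set (Zd d)) (v : Zd d) : ce A v ≤ 1 :=
  (antitone_nat_of_succ_le fun n => cn_succ_le hd A n v).le_of_tendsto (cn_tendsto hd A v) 0

lemma ce_nonneg {d : ℕ} (hd : 1 ≤ d) (A : Set (Zd d)) (v : Zd d) : 0 ≤ ce A v :=
  ge_of_tendsto' (cn_tendsto hd A v) fun n => cn_nonneg A n v

noncomputable def qq {d : ℕ} (A : Set (Zd d)) (v : Zd d) : ℝ := if v ∈ A then 0 else ce A v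

lemma ce_eq {d : ℕ} (hd : 1 ≤ d) (A : Set (Zd d)) (v : Zd d) : ce A v = avg (qq A) v := by
  have h1 := (cn_tendsto hd A v).comp (Filter.tendsto_add_atTop_nat 1)
  refine tendsto_nhds_unique h1 ?_
  refine avg_tendsto (f := fun n v => if v ∈ A then 0 else cn A n v) (fun v => ?_) v
  unfold qq
  split_ifs
  · exact tendsto_const_nhds
  · exact cn_tendsto hd A v

lemma cn_lower {d : ℕ} (hd : 3 ≤ d) (A : Set (Zd d)) (m : ℝ) (hm : 0 < m) (hmA : ∀ a ∈ A, m ≤ uu a) (n : ℕ) :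
    ∀ v, 1 - (if v ∈ A then 0 else cn A n v) ≤ m⁻¹ * uu v := by
  induction n with
  | zero =>
    intro v
    have := uu_pos v
    split_ifs with h
    · rw [inv_mul_eq_div, le_div_iff₀ hm]; have := hmA v h; linarith
    · simp [cn]; positivity
  | succ n ih =>
    intro v
    split_ifs with h
    · rw [inv_mul_eq_div, le_div_iff₀ hm]; have := hmA v h; linarith
    · have e : 1 - cn A (n+1) v = avg (fun v => 1 - (if v ∈ A then 0 else cn A n v)) v := by
        rw [avg_sub, avg_const (by omega)]; rfl
      rw [e]
      calc _ ≤ avg (fun v => m⁻¹ * uu v) v := avg_mono v fun e => ih _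
        _ = m⁻¹ * avg uu v := avg_mul _ _ _
        _ ≤ _ := mul_le_mul_of_nonneg_left (uu_super hd v).le (by positivity)

lemma qq_lower {d : ℕ} (hd : 3 ≤ d) (A : Set (Zd d)) (m : ℝ) (hm : 0 < m) (hmA : ∀ a ∈ A, m ≤ uu a) (v : Zd d) :
    1 - m⁻¹ * uu v ≤ qq A v := by
  have h := fun n => cn_lower hd A m hm hmA n v
  unfold qq
  split_ifs at h ⊢ with hv
  · have := h 0; linarith
  · refine ge_of_tendsto' (cn_tendsto (by omega) A v) fun n => ?_
    have := h n; linarith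

end Sol

namespace Sol

lemma inb_mono {d : ℕ} {m n : ℕ} (h : m ≤ n) {z : Zd d} (hz : inb m z) : inb n z := fun i =>
  (hz i).trans (by exact_mod_cast h)

lemma abs_dv_le {d : ℕ} (e : Fin d × Bool) (i : Fin d) : |dv e i| ≤ 1 := by
  obtain ⟨j, b⟩ := e
  by_cases h : i = j
  · subst h; cases b <;> simp [dv]
  · simp [dv, h]

lemma inb_dv {d : ℕ} {n : ℕ} {z : Zd d} (hz : inb n z) (e : Fin d × Bool) : inb (n + 1) (z + dv e) := by
  intro i
  have h1 := abs_add_le (z i) (dv e i)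
  have h2 := abs_dv_le e i
  have h3 := hz i
  push_cast
  simp only [Pi.add_apply]
  linarith

lemma inb_finite {d : ℕ} (n : ℕ) : {z : Zd d | inb n z}.Finite := by
  refine (Set.finite_Icc (fun _ => -(n:ℤ)) (fun _ => (n:ℤ)) : (Set.Icc (fun _ => -(n:ℤ)) (fun _ => (n:ℤ)) : Set (Zd d)).Finite).subset ?_
  intro z hz
  exact ⟨fun i => (abs_le.mp (hz i)).1, fun i => (abs_le.mp (hz i)).2⟩

lemma maxp {d : ℕ} (hd : 1 ≤ d) (A : Set (Zd d)) (n : ℕ) (w : Zd d → ℝ) (hA : ∀ z ∈ A, w z ≤ 0)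
    (hsh : ∀ z, inb (n + 1) z → ¬ inb n z → w z ≤ 0)
    (hsub : ∀ z, inb n z → z ∉ A → w z ≤ avg w z) : ∀ z, inb (n + 1) z → w z ≤ 0 := by
  by_contra hcon
  push Not at hcon
  obtain ⟨z0, hz0, hw0⟩ := hcon
  obtain ⟨x0, hx0, hmax⟩ := Set.exists_max_image {z : Zd d | inb (n + 1) z} w (inb_finite _) ⟨z0, hz0⟩
  have hM : 0 < w x0 := lt_of_lt_of_le hw0 (hmax z0 hz0)
  obtain ⟨x1, ⟨hx1, hx1e⟩, hmax1⟩ := Set.exists_max_image ({z : Zd d | inb (n + 1) z} ∩ {z | w z = w x0})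
    (fun z => z ⟨0, hd⟩) ((inb_finite _).inter_of_left _) ⟨x0, hx0, rfl⟩
  have hx1e' : w x1 = w x0 := hx1e
  have h1 : x1 ∉ A := fun h => by have := hA x1 h; linarith
  have h2 : inb n x1 := by
    by_contra h; have := hsh x1 hx1 h; linarith
  have h3 := hsub x1 h2 h1
  have hdp : (0:ℝ) < d := by exact_mod_cast hd
  have h4 : avg w x1 < avg (fun _ => w x0) x1 := by
    unfold avg
    apply div_lt_div_of_pos_right _ (by positivity)
    apply Finset.sum_lt_sum
    · intro e _; exact hmax _ (inb_dv h2 e)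
    · refine ⟨(⟨0, hd⟩, true), Finset.mem_univ _, ?_⟩
      refine lt_of_le_of_ne (hmax _ (inb_dv h2 _)) ?_
      intro h
      have := hmax1 _ ⟨inb_dv h2 _, h⟩
      simp [dv] at this
  rw [avg_const hd] at h4
  linarith

lemma l1_step {d : ℕ} (z : Zd d) (h : z ≠ 0) : ∃ e z', z = z' + dv e ∧ (∀ i, |z' i| ≤ |z i|) ∧
    ∑ i, (z i).natAbs = (∑ i, (z' i).natAbs) + 1 := by
  obtain ⟨i, hi⟩ : ∃ i, z i ≠ 0 := by
    by_contra hc; push Not at hc; exact h (funext hc)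
  refine ⟨(i, decide (0 < z i)), z - dv (i, decide (0 < z i)), by abel, ?_, ?_⟩
  · intro j
    by_cases hj : j = i
    · subst hj
      simp only [Pi.sub_apply, dv, Pi.single_eq_same]
      by_cases h0 : 0 < z j
      · simp [h0]; rw [abs_le]; rw [abs_of_pos h0]; constructor <;> omega
      · simp [h0]; rw [abs_of_nonpos (by omega : z j ≤ 0), abs_le]; constructor <;> omega
    · simp [dv, hj]
  · rw [← Finset.add_sum_erase _ _ (Finset.mem_univ i), ← Finset.add_sum_erase _ (fun j => ((z - dv (i, decide (0 < z i))) j).natAbs) (Finset.mem_univ i)]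
    have : ∀ j ∈ Finset.univ.erase i, ((z - dv (i, decide (0 < z i))) j).natAbs = (z j).natAbs := by
      intro j hj
      have : j ≠ i := (Finset.mem_erase.mp hj).1
      simp [dv, this]
    rw [Finset.sum_congr rfl this]
    have : (z i).natAbs = ((z - dv (i, decide (0 < z i))) i).natAbs + 1 := by
      simp only [Pi.sub_apply, dv, Pi.single_eq_same]
      by_cases h0 : 0 < z i
      · simp [h0]; omega
      · simp [h0]; omega
    omega

lemma chain {d : ℕ} (n : ℕ) (f : Zd d → ℝ) (ρ : ℝ) (hρ : 0 ≤ ρ)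
    (h : ∀ z, inb n z → ∀ e, f (z + dv e) ≤ ρ * f z) (k : ℕ) : ∀ z, inb n z → ∑ i, (z i).natAbs = k →
    f z ≤ ρ ^ k * f 0 ∧ f 0 ≤ ρ ^ k * f z := by
  induction k with
  | zero =>
    intro z _ hk
    have : z = 0 := by
      ext i
      have := (Finset.sum_eq_zero_iff.mp hk) i (Finset.mem_univ i)
      simpa using this
    subst this; simp
  | succ k ih =>
    intro z hz hk
    have hne : z ≠ 0 := by rintro rfl; simp at hk
    obtain ⟨e, z', h1, h2, h3⟩ := l1_step z hne
    have hz' : inb n z' := fun i => (h2 i).trans (hz i)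
    obtain ⟨h4, h5⟩ := ih z' hz' (by omega)
    constructor
    · rw [h1]
      calc _ ≤ ρ * f z' := h z' hz' e
        _ ≤ ρ * (ρ ^ k * f 0) := by gcongr
        _ = _ := by ring
    · have h6 : f z' ≤ ρ * f z := by
        have := h z hz (fl e)
        rw [dv_fl] at this
        rwa [show z + -dv e = z' by rw [h1]; abel] at this
      calc _ ≤ ρ ^ k * f z' := h5
        _ ≤ ρ ^ k * (ρ * f z) := by gcongr
        _ = _ := by ring

lemma l1_le {d : ℕ} (n : ℕ) (z : Zd d) (hz : inb n z) : ∑ i, (z i).natAbs ≤ d * n := by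
  calc _ ≤ ∑ i : Fin d, n := Finset.sum_le_sum fun i _ => by have := abs_le.mp (hz i); omega
    _ = _ := by simp

lemma unit_eq {d : ℕ} (v : Zd d) (h : ∑ i, (v i).natAbs = 1) : ∃ e, v = dv e := by
  have hne : v ≠ 0 := by rintro rfl; simp at h
  obtain ⟨e, z', h1, h2, h3⟩ := l1_step v hne
  refine ⟨e, ?_⟩
  have h4 : ∑ i, (z' i).natAbs = 0 := by omega
  have : z' = 0 := by
    ext i
    have := (Finset.sum_eq_zero_iff.mp h4) i (Finset.mem_univ i)
    simpa using this
  rw [h1, this]; simp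

set_option maxHeartbeats 1000000 in
/-- main analytic estimate -/
lemma analytic {d : ℕ} (hd : 3 ≤ d) (δ : ℝ) (hδ0 : 0 < δ) (hδ1 : δ < 1) : ∃ c₃ : ℝ, 2 ≤ c₃ ∧
    ∀ (L K : ℕ), 1 ≤ L → c₃ ≤ (K : ℝ) → ∀ A B : Set (Zd d), (∀ a ∈ A, inb L a) →
    (∀ v, (v ∈ B ∧ inb (K * L) v) ↔ v ∈ A) → ∀ x, x ∉ B → ¬ inb (K * L) x →
    ∃ α β : ℝ, 0 ≤ α ∧ β ≤ (1 + δ / 10) * α ∧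
      ∀ y ∈ A, α * ce A y ≤ avg (gg B x) y ∧ avg (gg B x) y ≤ β * ce A y := by
  have hd1 : 1 ≤ d := by omega
  have hdp : (0:ℝ) < d := by exact_mod_cast hd1
  obtain ⟨ε, hε⟩ : ∃ ε, ε = δ / 80 := ⟨_, rfl⟩
  have hε0 : 0 < ε := by rw [hε]; positivity
  have hε1 : ε < 1 / 80 := by rw [hε]; linarith
  obtain ⟨C, hC, hgrad⟩ := grad (d := d) hd1
  obtain ⟨r, hr, hly⟩ := lyap (d := d) ε hε0
  have hlog : 0 < Real.log (1 + ε) := Real.log_pos (by linarith)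
  have hr0 : (0:ℝ) ≤ r := by positivity
  refine ⟨max (2 * r + 4) (4 * C * d * r / Real.log (1 + ε)), le_max_of_le_left (by linarith), ?_⟩
  intro L K hL hK A B hAL hB x hxB hxK
  have hK1 : 2 * r + 4 ≤ K := by exact_mod_cast (le_max_left _ _).trans hK
  have hK2 : 4 * C * d * r / Real.log (1 + ε) ≤ K := (le_max_right _ _).trans hK
  have hKp : (0:ℝ) < K := by have : 0 < K := by omega
                             exact_mod_cast this
  have hLp : (0:ℝ) < L := by exact_mod_cast hL
  have hrL : r * L + 2 * L + (r * L + 2 * L) ≤ K * L := by nlinarith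
  obtain ⟨R, hR⟩ : ∃ R, R + (r * L + 2) = K * L := ⟨K * L - (r * L + 2), by omega⟩
  have hR2 : K * L ≤ 2 * R := by omega
  have hrL1 : 1 ≤ r * L := Nat.one_le_iff_ne_zero.mpr (by positivity)
  have hR1 : 1 ≤ R := by omega
  have hRp : (0:ℝ) < R := by exact_mod_cast hR1
  obtain ⟨m, hm, hmA, hmz⟩ := hly L hL
  have hmA' : ∀ a ∈ A, m ≤ uu a := fun a ha => hmA a (hAL a ha)
  set f := gg (B \ A) x with hf
  have hf0 : ∀ z, 0 ≤ f z := gg_nonneg _ _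
  have hharm : ∀ z, inb (K * L) z → avg f z = f z := by
    intro z hz
    have h1 := gg_rec hd (B \ A) x z
    have h2 : z ∉ B \ A := fun h => h.2 ((hB z).mp ⟨h.1, hz⟩)
    have h3 : dlt x z = 0 := by unfold dlt; rw [if_neg]; rintro rfl; exact hxK hz
    rw [h3, if_neg h2, zero_add] at h1
    exact h1.symm
  have hstep : ∀ z, inb (r * L + 1) z → ∀ e, f (z + dv e) ≤ (1 + C / R) * f z := by
    intro z hz e
    refine hgrad R hR1 f z hf0 ?_ e
    intro z' hz'
    apply hharm
    intro i
    have h1 := hz i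
    have h2 := hz' i
    have h3 := abs_add_le (z i) (z' i)
    have hR' : (R:ℤ) + (r * L + 2) = K * L := by exact_mod_cast hR
    push_cast at h1 ⊢
    simp only [Pi.add_apply]
    linarith
  have hρ1 : 1 ≤ 1 + C / R := by have : 0 < C / R := by positivity
                                 linarith
  have hpow : (1 + C / R) ^ (d * (r * L + 1)) ≤ 1 + ε := by
    have h1 : 1 + C / R ≤ Real.exp (C / R) := by have := Real.add_one_le_exp (C / R); linarith
    calc (1 + C / R) ^ (d * (r * L + 1)) ≤ Real.exp (C / R) ^ (d * (r * L + 1)) := by gcongr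
      _ = Real.exp ((d * (r * L + 1) : ℕ) * (C / R)) := by rw [Real.exp_nat_mul]
      _ ≤ Real.exp (Real.log (1 + ε)) := by
        apply Real.exp_le_exp.mpr
        have h2 : ((d * (r * L + 1) : ℕ) : ℝ) ≤ d * (2 * (r * L)) := by
          have : d * (r * L + 1) ≤ d * (2 * (r * L)) := Nat.mul_le_mul_left d (by omega)
          exact_mod_cast this
        have h3 : C / R ≤ 2 * C / (K * L) := by
          rw [div_le_div_iff₀ hRp (by positivity)]
          have : (K:ℝ) * L ≤ 2 * R := by exact_mod_cast hR2
          nlinarith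
        calc _ ≤ (d * (2 * (r * L))) * (2 * C / (K * L)) := by gcongr
          _ = (4 * C * d * r) / K := by field_simp; ring
          _ ≤ _ := by rw [div_le_iff₀ hKp]; rw [div_le_iff₀ hlog] at hK2; linarith
      _ = 1 + ε := Real.exp_log (by linarith)
  have hch : ∀ z, inb (r * L + 1) z → f z ≤ (1 + ε) * f 0 ∧ f 0 ≤ (1 + ε) * f z := by
    intro z hz
    have h1 := chain (r * L + 1) f (1 + C / R) (by linarith) hstep _ z hz rfl
    have h2 : (1 + C / R) ^ (∑ i, (z i).natAbs) ≤ 1 + ε :=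
      (pow_le_pow_right₀ hρ1 (l1_le _ z hz)).trans hpow
    exact ⟨h1.1.trans (mul_le_mul_of_nonneg_right h2 (hf0 0)), h1.2.trans (mul_le_mul_of_nonneg_right h2 (hf0 z))⟩
  have hLrL : L ≤ r * L := Nat.le_mul_of_pos_left L (by omega)
  have hcmp := gg_compare hd B (B \ A) A (fun v h => h.1) (fun v h1 h2 => by
      by_contra h; exact h2 ⟨h1, h⟩) x ((1 + ε) * f 0) m hm (mul_nonneg (by linarith) (hf0 0)) hmA'
      (fun a ha => (hch a (inb_mono (by omega) (hAL a ha))).1)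
  obtain ⟨F, hF⟩ : ∃ F, F = f 0 := ⟨_, rfl⟩
  have hF0 : 0 ≤ F := hF ▸ hf0 0
  rw [← hF] at hch hcmp
  have hshell : ∀ z, inb (r * L + 1) z → ¬ inb (r * L) z →
      (1 - 3 * ε) * F ≤ gg B x z ∧ gg B x z ≤ (1 + ε) * F ∧ 1 - ε ≤ qq A z := by
    intro z hz hz2
    obtain ⟨h1, h2⟩ := hch z hz
    obtain ⟨h3, h4⟩ := hcmp z
    have h5 := hmz z hz2
    have h6 := qq_lower hd A m hm hmA' z
    have h7 : m⁻¹ * uu z ≤ ε := by rw [inv_mul_le_iff₀ hm]; linarith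
    have h8 : (1 + ε) * F / m * uu z ≤ (1 + ε) * F * ε := by
      calc _ = (1 + ε) * F * (m⁻¹ * uu z) := by ring
        _ ≤ _ := mul_le_mul_of_nonneg_left h7 (by positivity)
    have h9 : (1 - ε) * F ≤ f z := by
      have : (1 - ε) * F ≤ (1 - ε) * ((1 + ε) * f z) := mul_le_mul_of_nonneg_left h2 (by linarith)
      have := hf0 z
      nlinarith [mul_nonneg (sq_nonneg ε) (hf0 z)]
    refine ⟨?_, h3.trans h1, by linarith⟩
    have h10 : ε * ε * F ≤ ε * F := by
      apply mul_le_mul_of_nonneg_right _ hF0; nlinarith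
    change f z - gg B x z ≤ _ at h4
    nlinarith
  have hggB : ∀ z ∈ A, gg B x z = 0 := by
    intro z hz
    have hzB := ((hB z).mpr hz).1
    rw [gg_rec hd, if_pos hzB]
    unfold dlt
    rw [if_neg]; simp
    rintro rfl; exact hxB hzB
  have hrK : r * L ≤ K * L := by omega
  have hggh : ∀ z, inb (r * L) z → z ∉ A → gg B x z = avg (gg B x) z := by
    intro z hz hzA
    have hzK : inb (K * L) z := inb_mono hrK hz
    have hzB : z ∉ B := fun h => hzA ((hB z).mp ⟨h, hzK⟩)
    conv_lhs => rw [gg_rec hd, if_neg hzB]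
    unfold dlt
    rw [if_neg]; simp
    rintro rfl; exact hxK hzK
  have hqh : ∀ z, z ∉ A → qq A z = avg (qq A) z := by
    intro z hz
    rw [← ce_eq hd1]; simp [qq, hz]
  have hqA : ∀ z ∈ A, qq A z = 0 := by intro z hz; simp [qq, hz]
  have hq1 : ∀ z, qq A z ≤ 1 := by
    intro z; unfold qq; split_ifs; · norm_num
    exact ce_le_one hd1 A z
  have hlow : ∀ z, inb (r * L + 1) z → (1 - 3 * ε) * F * qq A z - gg B x z ≤ 0 := by
    apply maxp hd1 A
    · intro z hz; rw [hqA z hz, hggB z hz]; simp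
    · intro z hz hz2
      have h1 := (hshell z hz hz2).1
      have h2 : (1 - 3 * ε) * F * qq A z ≤ (1 - 3 * ε) * F * 1 :=
        mul_le_mul_of_nonneg_left (hq1 z) (mul_nonneg (by linarith) hF0)
      linarith
    · intro z hz hzA
      rw [avg_sub, avg_mul, ← hggh z hz hzA, ← hqh z hzA]
  have hup : ∀ z, inb (r * L + 1) z → gg B x z - (1 + ε) * F / (1 - ε) * qq A z ≤ 0 := by
    apply maxp hd1 A
    · intro z hz; rw [hqA z hz, hggB z hz]; simp
    · intro z hz hz2
      obtain ⟨-, h1, h3⟩ := hshell z hz hz2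
      have h2 : (1 + ε) * F / (1 - ε) * (1 - ε) ≤ (1 + ε) * F / (1 - ε) * qq A z :=
        mul_le_mul_of_nonneg_left h3 (div_nonneg (by positivity) (by linarith))
      rw [div_mul_cancel₀ _ (by linarith)] at h2
      linarith
    · intro z hz hzA
      rw [avg_sub, avg_mul, ← hggh z hz hzA, ← hqh z hzA]
  refine ⟨(1 - 3 * ε) * F, (1 + ε) * F / (1 - ε), mul_nonneg (by linarith) hF0, ?_, ?_⟩
  · rw [div_le_iff₀ (by linarith)]
    have hδε : δ / 10 = 8 * ε := by rw [hε]; ring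
    rw [hδε]
    have : 1 + ε ≤ (1 + 8 * ε) * (1 - 3 * ε) * (1 - ε) := by
      have h1 : 0 ≤ ε * (3 - 29 * ε + 24 * ε ^ 2) := by
        apply mul_nonneg hε0.le
        have := sq_nonneg ε
        linarith
      have h2 : (1 + 8 * ε) * (1 - 3 * ε) * (1 - ε) - (1 + ε) = ε * (3 - 29 * ε + 24 * ε ^ 2) := by ring
      linarith
    calc _ ≤ (1 + 8 * ε) * (1 - 3 * ε) * (1 - ε) * F := mul_le_mul_of_nonneg_right this hF0
      _ = _ := by ring
  · intro y hy
    have hyb : inb (r * L) y := inb_mono hLrL (hAL y hy)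
    rw [ce_eq hd1, ← avg_mul, ← avg_mul]
    constructor
    · exact avg_mono y fun e => by have := hlow _ (inb_dv hyb e); linarith
    · exact avg_mono y fun e => by have := hup _ (inb_dv hyb e); linarith

lemma positivity_aux {d : ℕ} (hd : 3 ≤ d) (L K : ℕ) (hL : 1 ≤ L) (hK : 2 ≤ K) (A B : Set (Zd d)) (hAne : A.Nonempty)
    (hAL : ∀ a ∈ A, inb L a)
    (hB : ∀ v, (v ∈ B ∧ inb (K * L) v) ↔ v ∈ A) (x : Zd d) (hxB : x ∉ B) (hc : connSet Bᶜ) :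
    ∃ y ∈ A, 0 < avg (gg B x) y := by
  have hdp : (0:ℝ) < d := by have : 0 < d := by omega
                             exact_mod_cast this
  have hpos : ∀ (g : Zd d → ℝ) (z : Zd d) (e), (∀ v, 0 ≤ g v) → 0 < g (z + dv e) → 0 < avg g z := by
    intro g z e h0 h1
    apply div_pos _ (by positivity)
    exact lt_of_lt_of_le h1 (Finset.single_le_sum (f := fun e => g (z + dv e)) (fun _ _ => h0 _) (Finset.mem_univ e))
  obtain ⟨y, hy, hmax⟩ := Set.exists_max_image A (fun z => z ⟨0, by omega⟩) ((inb_finite L).subset hAL) hAne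
  refine ⟨y, hy, ?_⟩
  obtain ⟨e, he⟩ : ∃ e : Fin d × Bool, e = (⟨0, by omega⟩, true) := ⟨_, rfl⟩
  have hvA : y + dv e ∉ A := by
    intro h
    have := hmax _ h
    simp [he, dv] at this
  have hvB : y + dv e ∉ B := fun h => hvA ((hB _).mp ⟨h, inb_mono (by nlinarith) (inb_dv (hAL y hy) e)⟩)
  apply hpos _ y e (gg_nonneg B x)
  obtain ⟨n, f, h0, hn, hS, hadj⟩ := hc x hxB (y + dv e) hvB
  have : ∀ k ≤ n, 0 < bn B x k (f k) := by
    intro k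
    induction k with
    | zero => intro _; simp [bn, dlt, h0]
    | succ k ih =>
      intro hk
      have h1 := ih (by omega)
      obtain ⟨e', he'⟩ := unit_eq (f k - f (k+1)) (hadj k (by omega))
      simp only [bn]
      rw [if_neg (hS (k+1) hk)]
      apply hpos _ _ e' (bn_nonneg B x k)
      rw [← he']; simpa using h1
  have h2 := this n le_rfl
  rw [hn] at h2
  exact lt_of_lt_of_le h2 ((bn_summable hd B x _).le_tsum n (fun k _ => bn_nonneg B x k _))

end Sol

namespace Sol

/-! pathwise part -/

structure Good {d : ℕ} {Ω : Type*} [MeasurableSpace Ω] (W : SRW d Ω) (ω : Ω) : Prop where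
  pos : ∀ i, 0 < W.ζ i ω
  big : ∀ m, ∃ i ≥ m, 1 < W.ζ i ω

section
variable {d : ℕ} {Ω : Type*} [MeasurableSpace Ω] {W : SRW d Ω} {ω : Ω}

lemma S_succ (W : SRW d Ω) (n : ℕ) (ω : Ω) : W.S (n + 1) ω = W.S n ω + W.ζ n ω := by
  simp [SRW.S, Finset.sum_range_succ]

lemma S_zero (W : SRW d Ω) (ω : Ω) : W.S 0 ω = 0 := by simp [SRW.S]

lemma Good.mono (h : Good W ω) : StrictMono (fun n => W.S n ω) :=
  strictMono_nat_of_lt_succ fun n => by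
    have := h.pos n
    simp only [S_succ]; linarith

lemma Good.nonneg (h : Good W ω) (n : ℕ) : 0 ≤ W.S n ω := by
  have := h.mono.monotone (Nat.zero_le n)
  simpa [S_zero] using this

lemma Good.unbdd (h : Good W ω) (N : ℕ) : ∃ n, (N:ℝ) ≤ W.S n ω := by
  induction N with
  | zero => exact ⟨0, by simp [S_zero]⟩
  | succ N ih =>
    obtain ⟨n, hn⟩ := ih
    obtain ⟨i, hi, hi1⟩ := h.big n
    refine ⟨i + 1, ?_⟩
    have h1 : W.S n ω ≤ W.S i ω := h.mono.monotone hi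
    rw [S_succ]
    push_cast
    linarith

lemma Good.exists_idx (h : Good W ω) (t : ℝ) (ht : 0 ≤ t) : ∃ n, W.S n ω ≤ t ∧ t < W.S (n + 1) ω := by
  have hex : ∃ n, t < W.S n ω := by
    obtain ⟨N, hN⟩ := exists_nat_gt t
    obtain ⟨n, hn⟩ := h.unbdd N
    exact ⟨n, by linarith⟩
  have h1 := Nat.find_spec hex
  have h2 : Nat.find hex ≠ 0 := by
    intro h0
    rw [h0, S_zero] at h1; linarith
  obtain ⟨n, hn⟩ := Nat.exists_eq_succ_of_ne_zero h2
  refine ⟨n, ?_, by rw [hn] at h1; exact h1⟩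
  have := Nat.find_min hex (m := n) (by omega)
  linarith

lemma Good.X_eq (h : Good W ω) {t : ℝ} {n : ℕ} (h1 : W.S n ω ≤ t) (h2 : t < W.S (n + 1) ω) :
    W.X t ω = W.Y n ω := by
  unfold SRW.X SRW.jumpIdx
  congr 1
  have : {k : ℕ | W.S k ω ≤ t} = Set.Iic n := by
    ext k
    change W.S k ω ≤ t ↔ k ≤ n
    constructor
    · intro hk
      by_contra hc
      have : W.S (n + 1) ω ≤ W.S k ω := h.mono.monotone (by omega)
      linarith
    · intro hk
      have : W.S k ω ≤ W.S n ω := h.mono.monotone hk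
      linarith
  rw [this, csSup_Iic]

lemma Good.hit_eq (h : Good W ω) (B : Set (Zd d)) (N : ℕ) (hN : W.Y N ω ∈ B) (hk : ∀ k < N, W.Y k ω ∉ B) :
    W.hit B ω = ENNReal.ofReal (W.S N ω) := by
  unfold SRW.hit SRW.hitFrom
  apply le_antisymm
  · apply sInf_le
    refine ⟨⟨W.S N ω, h.nonneg N⟩, ?_, zero_le, ?_⟩
    · rw [ENNReal.ofReal_eq_coe_nnreal (h.nonneg N)]; rfl
    · change W.X (W.S N ω) ω ∈ B
      rw [h.X_eq le_rfl (h.mono (Nat.lt_succ_self N))]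
      exact hN
  · apply le_sInf
    rintro u ⟨s, rfl, -, hs⟩
    obtain ⟨n, h1, h2⟩ := h.exists_idx s s.2
    rw [h.X_eq h1 h2] at hs
    have : N ≤ n := by
      by_contra hc
      exact hk n (by omega) hs
    have h3 : W.S N ω ≤ W.S n ω := h.mono.monotone this
    rw [ENNReal.ofReal_le_iff_le_toReal ENNReal.coe_ne_top]
    simp only [ENNReal.coe_toReal]
    linarith

lemma Good.hit_top (h : Good W ω) (B : Set (Zd d)) (hB : ∀ k, W.Y k ω ∉ B) : W.hit B ω = ⊤ := by
  unfold SRW.hit SRW.hitFrom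
  rw [sInf_eq_top]
  rintro u ⟨s, rfl, -, hs⟩
  obtain ⟨n, h1, h2⟩ := h.exists_idx s s.2
  rw [h.X_eq h1 h2] at hs
  exact absurd hs (hB n)

lemma Good.hit_iff (h : Good W ω) (B : Set (Zd d)) (y : Zd d) (hy : y ∈ B) :
    (W.hit B ω < ⊤ ∧ W.Xat (W.hit B) ω = y) ↔ ∃ N, W.Y N ω = y ∧ ∀ k < N, W.Y k ω ∉ B := by
  by_cases hex : ∃ N, W.Y N ω ∈ B
  · have h1 := Nat.find_spec hex
    have h2 : ∀ k < Nat.find hex, W.Y k ω ∉ B := fun k hk => Nat.find_min hex hk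
    obtain ⟨N, hN⟩ : ∃ N, N = Nat.find hex := ⟨_, rfl⟩
    rw [← hN] at h1 h2
    have h3 := h.hit_eq B N h1 h2
    have h4 : W.Xat (W.hit B) ω = W.Y N ω := by
      unfold SRW.Xat
      rw [h3, ENNReal.toReal_ofReal (h.nonneg N)]
      exact h.X_eq le_rfl (h.mono (Nat.lt_succ_self N))
    rw [h4, h3]
    constructor
    · rintro ⟨-, h5⟩
      exact ⟨N, h5, h2⟩
    · rintro ⟨M, h5, h6⟩
      refine ⟨ENNReal.ofReal_lt_top, ?_⟩
      have : M = N := by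
        rcases lt_trichotomy M N with hlt | rfl | hlt
        · exact absurd (h5 ▸ hy) (h2 M hlt)
        · rfl
        · exact absurd h1 (h6 N hlt)
      rw [← this, h5]
  · push Not at hex
    rw [h.hit_top B hex]
    simp
    intro N hN
    exact absurd (hN ▸ hy) (hex N)

lemma Good.tilde_iff (h : Good W ω) (A : Set (Zd d)) :
    W.hitTilde A ω = ⊤ ↔ ∀ n, W.Y (n + 1) ω ∉ A := by
  have hS1 : W.S 1 ω = W.ζ 0 ω := by rw [S_succ, S_zero, zero_add]
  unfold SRW.hitTilde SRW.hitFrom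
  rw [sInf_eq_top]
  constructor
  · intro hh n hn
    have h0 := h.nonneg (n + 1)
    have := hh (ENNReal.ofReal (W.S (n + 1) ω)) ⟨⟨W.S (n+1) ω, h0⟩, ?_, ?_, ?_⟩
    · exact ENNReal.ofReal_ne_top this
    · rw [ENNReal.ofReal_eq_coe_nnreal h0]; rfl
    · apply ENNReal.ofReal_le_ofReal
      rw [← hS1]
      exact h.mono.monotone (by omega)
    · change W.X (W.S (n+1) ω) ω ∈ A
      rwa [h.X_eq le_rfl (h.mono (Nat.lt_succ_self _))]
  · rintro hA u ⟨s, rfl, hs0, hs⟩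
    obtain ⟨n, h1, h2⟩ := h.exists_idx s s.2
    rw [h.X_eq h1 h2] at hs
    have : n ≠ 0 := by
      rintro rfl
      rw [ENNReal.ofReal_le_iff_le_toReal ENNReal.coe_ne_top, ENNReal.coe_toReal] at hs0
      rw [zero_add, hS1] at h2
      linarith
    obtain ⟨k, rfl⟩ := Nat.exists_eq_succ_of_ne_zero this
    exact absurd hs (hA k)

end

/-! exponential measure -/

lemma exp_set (s : Set ℝ) (hs : MeasurableSet s) : expMeasure s = ∫⁻ t in s ∩ Set.Ioi 0, ENNReal.ofReal (Real.exp (-t)) := by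
  unfold expMeasure
  rw [withDensity_apply _ hs]
  have : (fun t : ℝ => ENNReal.ofReal (if 0 < t then Real.exp (-t) else 0)) =
      (Set.Ioi 0).indicator (fun t => ENNReal.ofReal (Real.exp (-t))) := by
    ext t
    by_cases h : 0 < t <;> simp [Set.indicator, h]
  rw [this, setLIntegral_indicator measurableSet_Ioi, Set.inter_comm]

lemma exp_Ioi (a : ℝ) : ∫⁻ t in Set.Ioi a, ENNReal.ofReal (Real.exp (-t)) = ENNReal.ofReal (Real.exp (-a)) := by
  rw [← ofReal_integral_eq_lintegral_ofReal (integrableOn_exp_neg_Ioi a) (Filter.Eventually.of_forall fun t => (Real.exp_pos _).le)]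
  rw [integral_exp_neg_Ioi]

lemma exp_univ : expMeasure Set.univ = 1 := by
  rw [exp_set _ MeasurableSet.univ, Set.univ_inter, exp_Ioi]; simp

lemma exp_neg0 : expMeasure (Set.Iic 0) = 0 := by
  rw [exp_set _ measurableSet_Iic]
  have : Set.Iic (0:ℝ) ∩ Set.Ioi 0 = ∅ := by ext t; simp
  rw [this]; simp

lemma exp_Iic1 : expMeasure (Set.Iic 1) < 1 := by
  have h1 : expMeasure (Set.Iic 1) + expMeasure (Set.Ioi 1) = 1 := by
    rw [← exp_univ, ← measure_union _ measurableSet_Ioi]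
    · congr 1; ext t; simp
    · rw [Set.disjoint_left]; intro t; simp
  have h2 : expMeasure (Set.Ioi 1) = ENNReal.ofReal (Real.exp (-1)) := by
    rw [exp_set _ measurableSet_Ioi]
    have : Set.Ioi (1:ℝ) ∩ Set.Ioi 0 = Set.Ioi 1 := by ext t; simp
    rw [this, exp_Ioi]
  have h3 : 0 < expMeasure (Set.Ioi 1) := by rw [h2]; simp [Real.exp_pos]
  have h4 : expMeasure (Set.Iic 1) ≠ ⊤ := by
    intro h; rw [h] at h1; simp at h1
  rw [← h1]
  exact ENNReal.lt_add_right h4 h3.ne'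

end Sol

namespace Sol
section
variable {d : ℕ} {Ω : Type*} [MeasurableSpace Ω] (W : SRW d Ω)

lemma part {β : Type*} [MeasurableSpace β] [MeasurableSingletonClass β] [Countable β]
    (μ : Measure Ω) (f : Ω → β) (hf : Measurable f) (S : Set Ω) :
    μ S = ∑' v, μ {ω | ω ∈ S ∧ f ω = v} := by
  have h := tsum_measure_preimage_singleton (μ := μ.restrict S) (f := f) (s := Set.univ) Set.countable_univ
    (fun y _ => hf (measurableSet_singleton y))
  rw [tsum_univ (fun v => μ.restrict S (f ⁻¹' {v}))] at h
  rw [Set.preimage_univ, Measure.restrict_apply_univ] at h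
  rw [← h]
  refine tsum_congr fun v => ?_
  rw [Measure.restrict_apply (hf (measurableSet_singleton v))]
  congr 1
  ext ω
  exact and_comm

noncomputable def FF (n : ℕ) (ω : Ω) : Fin n → Zd d := fun i => W.Y ((i:ℕ) + 1) ω - W.Y (i:ℕ) ω

lemma FF_meas (n : ℕ) : Measurable (FF W n) :=
  measurable_pi_lambda _ fun _ => (W.measurable_Y _).sub (W.measurable_Y _)

lemma law_F (x : Zd d) (n : ℕ) (s : Fin n → Zd d) : W.P x {ω | FF W n ω = s} = ∏ i, stepP d (s i) := by
  have h := W.law x n s (fun _ => Set.univ) (fun _ => MeasurableSet.univ)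
  simp only [exp_univ, Finset.prod_const_one, mul_one, Set.mem_univ, implies_true, and_true] at h
  rw [← h]
  congr 1
  ext ω
  exact funext_iff

lemma law_ζ (x : Zd d) (n : ℕ) (I : Fin n → Set ℝ) (hI : ∀ i, MeasurableSet (I i)) :
    W.P x {ω | ∀ i : Fin n, W.ζ i ω ∈ I i} = ∏ i, expMeasure (I i) := by
  have := W.isProb x
  have h1 : ∑' s : Fin n → Zd d, ∏ i, stepP d (s i) = 1 := by
    rw [← measure_univ (μ := W.P x), part (W.P x) (FF W n) (FF_meas W n) Set.univ]
    refine tsum_congr fun s => ?_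
    rw [← law_F W x]
    congr 1
    ext ω
    exact ⟨fun h => ⟨trivial, h⟩, fun h => h.2⟩
  rw [part (W.P x) (FF W n) (FF_meas W n)]
  calc _ = ∑' s : Fin n → Zd d, (∏ i, stepP d (s i)) * ∏ i, expMeasure (I i) := by
        refine tsum_congr fun s => ?_
        rw [← W.law x n s I hI]
        congr 1
        ext ω
        exact ⟨fun h => ⟨fun i => congrFun h.2 i, h.1⟩, fun h => ⟨h.2, funext h.1⟩⟩
    _ = _ := by rw [ENNReal.tsum_mul_right, h1, one_mul]

lemma ae_good (x : Zd d) : ∀ᵐ ω ∂ W.P x, W.Y 0 ω = x ∧ Good W ω := by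
  have := W.isProb x
  have h0 : ∀ᵐ ω ∂ W.P x, W.Y 0 ω = x := by
    have h := W.Y_zero x
    have hm : MeasurableSet {ω | W.Y 0 ω = x} := (W.measurable_Y 0) (measurableSet_singleton x)
    exact (prob_compl_eq_zero_iff hm).mpr h
  have h1 : ∀ᵐ ω ∂ W.P x, ∀ i, 0 < W.ζ i ω := by
    rw [ae_all_iff]
    intro i
    have h := law_ζ W x (i + 1) (fun j => if (j:ℕ) = i then Set.Iic 0 else Set.univ)
      (fun j => by split_ifs; exacts [measurableSet_Iic, MeasurableSet.univ])
    have h2 : ∏ j : Fin (i+1), expMeasure (if (j:ℕ) = i then Set.Iic 0 else Set.univ) = 0 :=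
      Finset.prod_eq_zero (Finset.mem_univ ⟨i, by omega⟩) (by simp [exp_neg0])
    rw [h2] at h
    rw [ae_iff]
    refine measure_mono_null ?_ h
    intro ω hω j
    have hω' : ¬ 0 < W.ζ i ω := hω
    split_ifs with hj
    · rw [hj]; exact not_lt.mp hω'
    · trivial
  have h2 : ∀ᵐ ω ∂ W.P x, ∀ m, ∃ i ≥ m, 1 < W.ζ i ω := by
    rw [ae_all_iff]
    intro m
    rw [ae_iff]
    have hb : ∀ n : ℕ, W.P x {ω | ¬ ∃ i ≥ m, 1 < W.ζ i ω} ≤ expMeasure (Set.Iic 1) ^ n := by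
      intro n
      have h := law_ζ W x (m + n) (fun j => if m ≤ (j:ℕ) then Set.Iic 1 else Set.univ)
        (fun j => by split_ifs; exacts [measurableSet_Iic, MeasurableSet.univ])
      rw [Fin.prod_univ_add] at h
      have e1 : ∀ i : Fin m, ¬ (m ≤ (i:ℕ)) := fun i => by omega
      simp [e1, exp_univ] at h
      rw [← h]
      apply measure_mono
      intro ω hω j
      have hω' : ¬ ∃ i ≥ m, 1 < W.ζ i ω := hω
      push Not at hω'
      exact fun hj => hω' j hj
    have ht := ENNReal.tendsto_pow_atTop_nhds_zero_of_lt_one exp_Iic1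
    exact le_antisymm (ge_of_tendsto' ht hb) zero_le
  filter_upwards [h0, h1, h2] with ω a b c using ⟨a, b, c⟩

lemma markov0 (x : Zd d) (n : ℕ) (G : Set (Fin n → Zd d)) (u : Zd d) :
    W.P x {ω | FF W n ω ∈ G ∧ W.Y (n + 1) ω - W.Y n ω = u} = W.P x {ω | FF W n ω ∈ G} * stepP d u := by
  rw [part (W.P x) (FF W n) (FF_meas W n), part (W.P x) (FF W n) (FF_meas W n) {ω | FF W n ω ∈ G}, ← ENNReal.tsum_mul_right]
  refine tsum_congr fun s => ?_
  by_cases hs : s ∈ G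
  · have e1 : {ω | ω ∈ {ω | FF W n ω ∈ G} ∧ FF W n ω = s} = {ω | FF W n ω = s} := by
      ext ω; exact ⟨fun h => h.2, fun h => ⟨by have h' : FF W n ω = s := h
                                               show FF W n ω ∈ G
                                               rwa [h'], h⟩⟩
    have e2 : {ω | ω ∈ {ω | FF W n ω ∈ G ∧ W.Y (n + 1) ω - W.Y n ω = u} ∧ FF W n ω = s} =
        {ω | FF W (n+1) ω = Fin.snoc s u} := by
      ext ω
      have e3 : FF W (n+1) ω = Fin.snoc (FF W n ω) (W.Y (n + 1) ω - W.Y n ω) := by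
        ext i
        refine Fin.lastCases ?_ (fun i => ?_) i
        · simp [FF]
        · simp [FF]
      show ((FF W n ω ∈ G ∧ W.Y (n + 1) ω - W.Y n ω = u) ∧ FF W n ω = s) ↔ FF W (n+1) ω = Fin.snoc s u
      rw [e3]
      constructor
      · rintro ⟨⟨-, h1⟩, h2⟩; rw [h1, h2]
      · intro h
        obtain ⟨h1, h2⟩ := Fin.snoc_injective2 h
        exact ⟨⟨by rwa [h1], h2⟩, h1⟩
    rw [e1, e2, law_F, law_F, Fin.prod_univ_castSucc]
    simp
  · have e1 : {ω | ω ∈ {ω | FF W n ω ∈ G} ∧ FF W n ω = s} = ∅ := by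
      ext ω; constructor
      · rintro ⟨h1, h2⟩
        have h1' : FF W n ω ∈ G := h1
        rw [h2] at h1'; exact hs h1'
      · intro h; exact h.elim
    have e2 : {ω | ω ∈ {ω | FF W n ω ∈ G ∧ W.Y (n + 1) ω - W.Y n ω = u} ∧ FF W n ω = s} = ∅ := by
      ext ω; constructor
      · rintro ⟨⟨h1, -⟩, h2⟩
        rw [h2] at h1; exact hs h1
      · intro h; exact h.elim
    rw [e1, e2]; simp

noncomputable def pth {n : ℕ} (x : Zd d) (s : Fin n → Zd d) (k : ℕ) : Zd d :=
  x + ∑ j ∈ Finset.range k, if h : j < n then s ⟨j, h⟩ else 0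

lemma pth_eq (x : Zd d) (ω : Ω) (h0 : W.Y 0 ω = x) (n k : ℕ) (hk : k ≤ n) : pth x (FF W n ω) k = W.Y k ω := by
  induction k with
  | zero => simp [pth, h0]
  | succ k ih =>
    have := ih (by omega)
    unfold pth at this ⊢
    rw [Finset.sum_range_succ, ← add_assoc, this, dif_pos (by omega)]
    simp [FF]

lemma markov (x : Zd d) (n : ℕ) (Q : (ℕ → Zd d) → Prop) (hQ : ∀ a b, (∀ k ≤ n, a k = b k) → Q a → Q b) (u : Zd d) :
    W.P x {ω | Q (fun k => W.Y k ω) ∧ W.Y (n + 1) ω - W.Y n ω = u} = W.P x {ω | Q (fun k => W.Y k ω)} * stepP d u := by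
  have key : ∀ᵐ ω ∂ W.P x, Q (fun k => W.Y k ω) ↔ FF W n ω ∈ {s | Q (pth x s)} := by
    filter_upwards [ae_good W x] with ω hω
    constructor
    · intro h
      exact hQ _ _ (fun k hk => (pth_eq W x ω hω.1 n k hk).symm) h
    · intro h
      exact hQ _ _ (fun k hk => pth_eq W x ω hω.1 n k hk) h
  have h1 : W.P x {ω | Q (fun k => W.Y k ω) ∧ W.Y (n + 1) ω - W.Y n ω = u} =
      W.P x {ω | FF W n ω ∈ {s | Q (pth x s)} ∧ W.Y (n + 1) ω - W.Y n ω = u} := by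
    apply measure_congr
    filter_upwards [key] with ω hω
    exact propext (and_congr_left fun _ => hω)
  have h2 : W.P x {ω | Q (fun k => W.Y k ω)} = W.P x {ω | FF W n ω ∈ {s | Q (pth x s)}} := by
    apply measure_congr
    filter_upwards [key] with ω hω
    exact propext hω
  rw [h1, h2, markov0]

lemma dv_inj : Function.Injective (dv (d := d)) := by
  rintro ⟨i, b⟩ ⟨j, c⟩ h
  have h1 := congrFun h i
  by_cases hij : i = j
  · subst hij
    cases b <;> cases c <;> simp [dv] at h1 ⊢
  · cases b <;> cases c <;> simp [dv, hij] at h1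

lemma l1_dv (e : Fin d × Bool) : ∑ i, (dv e i).natAbs = 1 := by
  obtain ⟨i, b⟩ := e
  rw [Finset.sum_eq_single i]
  · cases b <;> simp [dv]
  · intro j _ hj; simp [dv, hj]
  · simp

lemma stepP_eq (u : Zd d) : stepP d u = ∑ e : Fin d × Bool, if u = dv e then ((2 * d : ℕ) : ℝ≥0∞)⁻¹ else 0 := by
  unfold stepP
  split_ifs with h
  · obtain ⟨e, rfl⟩ := unit_eq u h
    rw [Finset.sum_eq_single e]
    · simp
    · intro e' _ he; rw [if_neg]; intro h; exact he (dv_inj h).symm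
    · simp
  · symm
    apply Finset.sum_eq_zero
    intro e _
    rw [if_neg]; rintro rfl; exact h (l1_dv e)

lemma sum_fl {M : Type*} [AddCommMonoid M] (g : Fin d × Bool → M) : ∑ e, g (fl e) = ∑ e, g e := by
  rw [Fintype.sum_prod_type, Fintype.sum_prod_type]
  simp [fl, add_comm]

lemma tsum_step (g : Zd d → ℝ≥0∞) (v' : Zd d) :
    ∑' v, g v * stepP d (v' - v) = ∑ e : Fin d × Bool, g (v' + dv e) * ((2 * d : ℕ) : ℝ≥0∞)⁻¹ := by
  rw [← sum_fl (fun e => g (v' + dv e) * ((2 * d : ℕ) : ℝ≥0∞)⁻¹)]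
  simp only [stepP_eq, Finset.mul_sum]
  rw [Summable.tsum_finsetSum (fun _ _ => ENNReal.summable)]
  refine Finset.sum_congr rfl fun e _ => ?_
  rw [tsum_eq_single (v' + dv (fl e))]
  · rw [dv_fl]; simp
  · intro v hv
    rw [if_neg]; · simp
    intro h
    apply hv
    rw [dv_fl, ← h]; abel

lemma ofReal_avg (hd : 1 ≤ d) (g : Zd d → ℝ) (hg : ∀ v, 0 ≤ g v) (z : Zd d) :
    ∑ e : Fin d × Bool, ENNReal.ofReal (g (z + dv e)) * ((2 * d : ℕ) : ℝ≥0∞)⁻¹ = ENNReal.ofReal (avg g z) := by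
  have hdp : (0:ℝ) < 2 * d := by have : (0:ℝ) < d := by exact_mod_cast hd
                                 linarith
  unfold avg
  rw [← Finset.sum_mul, ENNReal.ofReal_div_of_pos hdp, ENNReal.ofReal_sum_of_nonneg (fun _ _ => hg _), div_eq_mul_inv]
  congr 2
  rw [show (2 * (d:ℝ)) = ((2 * d : ℕ) : ℝ) by push_cast; ring, ENNReal.ofReal_natCast]

end
end Sol

namespace Sol
section
variable {d : ℕ} {Ω : Type*} [MeasurableSpace Ω] (W : SRW d Ω)

lemma one_step (hd : 1 ≤ d) (B : Set (Zd d)) (x : Zd d) (n : ℕ)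
    (h : ∀ v, W.P x {ω | (∀ k, 1 ≤ k → k ≤ n → W.Y k ω ∉ B) ∧ W.Y n ω = v} = ENNReal.ofReal (bn B x n v)) (v' : Zd d) :
    W.P x {ω | (∀ k, 1 ≤ k → k ≤ n → W.Y k ω ∉ B) ∧ W.Y (n + 1) ω = v'} = ENNReal.ofReal (avg (bn B x n) v') := by
  rw [part (W.P x) (W.Y n) (W.measurable_Y n), ← ofReal_avg hd _ (bn_nonneg B x n), ← tsum_step (fun v => ENNReal.ofReal (bn B x n v))]
  refine tsum_congr fun v => ?_
  rw [← h v]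
  have := markov W x n (fun a => (∀ k, 1 ≤ k → k ≤ n → a k ∉ B) ∧ a n = v) (by
    rintro a b hab ⟨h1, h2⟩
    refine ⟨fun k hk1 hk2 => ?_, ?_⟩
    · rw [← hab k hk2]; exact h1 k hk1 hk2
    · rw [← hab n le_rfl]; exact h2) (v' - v)
  rw [← this]
  congr 1
  ext ω
  show ((∀ k, 1 ≤ k → k ≤ n → W.Y k ω ∉ B) ∧ W.Y (n + 1) ω = v') ∧ W.Y n ω = v ↔
    ((∀ k, 1 ≤ k → k ≤ n → W.Y k ω ∉ B) ∧ W.Y n ω = v) ∧ W.Y (n + 1) ω - W.Y n ω = v' - v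
  constructor
  · rintro ⟨⟨a, b⟩, c⟩; exact ⟨⟨a, c⟩, by rw [b, c]⟩
  · rintro ⟨⟨a, c⟩, b⟩; rw [c] at b; exact ⟨⟨a, sub_left_injective b⟩, c⟩

lemma pn_eq (hd : 1 ≤ d) (B : Set (Zd d)) (x : Zd d) (n : ℕ) :
    ∀ v, W.P x {ω | (∀ k, 1 ≤ k → k ≤ n → W.Y k ω ∉ B) ∧ W.Y n ω = v} = ENNReal.ofReal (bn B x n v) := by
  induction n with
  | zero =>
    intro v
    by_cases hv : v = x
    · have e : {ω | (∀ k, 1 ≤ k → k ≤ 0 → W.Y k ω ∉ B) ∧ W.Y 0 ω = v} = {ω | W.Y 0 ω = x} := by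
        ext ω
        rw [hv]
        exact ⟨fun h => h.2, fun h => ⟨fun k h1 h2 => by omega, h⟩⟩
      rw [e, W.Y_zero]; simp [bn, dlt, hv]
    · have : ENNReal.ofReal (bn B x 0 v) = 0 := by simp [bn, dlt, hv]
      rw [this, measure_eq_zero_iff_ae_notMem]
      filter_upwards [ae_good W x] with ω hω h
      exact hv (h.2.symm.trans hω.1)
  | succ n ih =>
    intro v
    have h1 := one_step W hd B x n ih v
    simp only [bn]
    split_ifs with hv
    · have e : {ω | (∀ k, 1 ≤ k → k ≤ n + 1 → W.Y k ω ∉ B) ∧ W.Y (n+1) ω = v} = ∅ := by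
        ext ω
        constructor
        · rintro ⟨h1, h2⟩
          exact h1 (n+1) (by omega) le_rfl (h2 ▸ hv)
        · intro h; exact h.elim
      rw [e]; simp
    · rw [← h1]
      congr 1
      ext ω
      constructor
      · rintro ⟨a, b⟩; exact ⟨fun k h1 h2 => a k h1 (by omega), b⟩
      · rintro ⟨a, b⟩
        refine ⟨fun k h1 h2 => ?_, b⟩
        rcases Nat.lt_or_ge k (n+1) with h | h
        · exact a k h1 (by omega)
        · have : k = n + 1 := by omega
          rw [this, b]; exact hv

lemma entrance (hd : 3 ≤ d) (B : Set (Zd d)) (x y : Zd d) (hx : x ∉ B) (hy : y ∈ B) :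
    W.P x {ω | W.hit B ω < ⊤ ∧ W.Xat (W.hit B) ω = y} = ENNReal.ofReal (avg (gg B x) y) := by
  have hd1 : 1 ≤ d := by omega
  have e1 : W.P x {ω | W.hit B ω < ⊤ ∧ W.Xat (W.hit B) ω = y} =
      W.P x (⋃ n : ℕ, {ω | (∀ k, 1 ≤ k → k ≤ n → W.Y k ω ∉ B) ∧ W.Y (n + 1) ω = y}) := by
    apply measure_congr
    filter_upwards [ae_good W x] with ω hω
    apply propext
    have h1 := hω.2.hit_iff B y hy
    refine Iff.trans h1 ?_
    rw [show (⋃ n : ℕ, {ω | (∀ k, 1 ≤ k → k ≤ n → W.Y k ω ∉ B) ∧ W.Y (n + 1) ω = y}) ω ↔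
      ω ∈ (⋃ n : ℕ, {ω | (∀ k, 1 ≤ k → k ≤ n → W.Y k ω ∉ B) ∧ W.Y (n + 1) ω = y}) from Iff.rfl, Set.mem_iUnion]
    constructor
    · rintro ⟨N, h2, h3⟩
      have : N ≠ 0 := by
        rintro rfl
        rw [hω.1] at h2; exact hx (h2 ▸ hy)
      obtain ⟨n, rfl⟩ := Nat.exists_eq_succ_of_ne_zero this
      exact ⟨n, fun k _ hk => h3 k (by omega), h2⟩
    · rintro ⟨n, h2, h3⟩
      refine ⟨n + 1, h3, fun k hk => ?_⟩
      rcases Nat.eq_zero_or_pos k with rfl | hk0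
      · rw [hω.1]; exact hx
      · exact h2 k hk0 (by omega)
  rw [e1, measure_iUnion]
  · simp only [one_step W hd1 B x _ (pn_eq W hd1 B x _)]
    rw [← ENNReal.ofReal_tsum_of_nonneg]
    · congr 1
      unfold avg
      rw [tsum_div_const, Summable.tsum_finsetSum (fun _ _ => bn_summable hd B x _)]
      rfl
    · exact fun n => avg_nonneg (bn_nonneg B x n) y
    · unfold avg
      exact (summable_sum fun _ _ => bn_summable hd B x _).div_const _
  · intro n m hnm
    rw [Function.onFun, Set.disjoint_left]
    rintro ω ⟨h1, h2⟩ ⟨h3, h4⟩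
    rcases lt_or_gt_of_ne hnm with h | h
    · exact h3 (n+1) (by omega) (by omega) (h2 ▸ hy)
    · exact h1 (m+1) (by omega) (by omega) (h4 ▸ hy)
  · intro n
    have hB : MeasurableSet B := (Set.to_countable B).measurableSet
    have : {ω | (∀ k, 1 ≤ k → k ≤ n → W.Y k ω ∉ B) ∧ W.Y (n + 1) ω = y} =
      (⋂ k, ⋂ (_ : 1 ≤ k), ⋂ (_ : k ≤ n), (W.Y k ⁻¹' B)ᶜ) ∩ W.Y (n + 1) ⁻¹' {y} := by
      ext ω
      simp
    rw [this]
    refine MeasurableSet.inter ?_ (W.measurable_Y _ (measurableSet_singleton y))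
    exact MeasurableSet.iInter fun k => MeasurableSet.iInter fun _ => MeasurableSet.iInter fun _ =>
      (W.measurable_Y k hB).compl

lemma bn_cn (hd : 1 ≤ d) (A : Set (Zd d)) (y : Zd d) (n : ℕ) : ∀ m,
    ∑' v, ENNReal.ofReal (bn A y n v) * ENNReal.ofReal (cn A m v) = ENNReal.ofReal (cn A (n + m) y) := by
  induction n with
  | zero =>
    intro m
    rw [tsum_eq_single y]
    · simp [bn, dlt]
    · intro v hv; simp [bn, dlt, hv]
  | succ n ih =>
    intro m
    rw [show n + 1 + m = n + (m + 1) by ring, ← ih (m + 1)]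
    set c := ((2 * d : ℕ) : ℝ≥0∞)⁻¹ with hc
    set χ : Zd d → ℝ := fun v => if v ∈ A then 0 else cn A m v with hχ
    have hχ0 : ∀ v, 0 ≤ χ v := fun v => by
      simp only [hχ]; split_ifs; exacts [le_rfl, cn_nonneg A m v]
    have h1 : ∀ v, ENNReal.ofReal (bn A y (n+1) v) * ENNReal.ofReal (cn A m v) =
        ∑ e : Fin d × Bool, ENNReal.ofReal (bn A y n (v + dv e)) * c * ENNReal.ofReal (χ v) := by
      intro v
      simp only [bn, hχ]
      split_ifs with hv
      · simp
      · rw [← ofReal_avg hd _ (bn_nonneg A y n), Finset.sum_mul]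
    have h2 : ∀ v, ENNReal.ofReal (bn A y n v) * ENNReal.ofReal (cn A (m + 1) v) =
        ∑ e : Fin d × Bool, ENNReal.ofReal (bn A y n v) * (ENNReal.ofReal (χ (v + dv e)) * c) := by
      intro v
      rw [← Finset.mul_sum, ofReal_avg hd _ hχ0]
      rfl
    rw [tsum_congr h1, tsum_congr h2, Summable.tsum_finsetSum (fun _ _ => ENNReal.summable),
      Summable.tsum_finsetSum (fun _ _ => ENNReal.summable)]
    rw [← sum_fl]
    refine Finset.sum_congr rfl fun e _ => ?_
    rw [← (Equiv.addRight (dv e)).tsum_eq]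
    refine tsum_congr fun v => ?_
    rw [dv_fl]
    simp only [Equiv.coe_addRight, add_neg_cancel_right]
    ring

lemma eqm_eq (hd : 1 ≤ d) (A : Set (Zd d)) (y : Zd d) (hy : y ∈ A) : W.eqm A y = ce A y := by
  have := W.isProb y
  unfold SRW.eqm
  rw [if_pos hy]
  have hA : MeasurableSet A := (Set.to_countable A).measurableSet
  have hst : ∀ n, W.P y {ω | ∀ k, 1 ≤ k → k ≤ n → W.Y k ω ∉ A} = ENNReal.ofReal (cn A n y) := by
    intro n
    rw [part (W.P y) (W.Y n) (W.measurable_Y n)]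
    have h := bn_cn hd A y n 0
    rw [add_zero] at h
    rw [← h]
    refine tsum_congr fun v => ?_
    have h2 := pn_eq W hd A y n v
    simp only [cn, ENNReal.ofReal_one, mul_one]
    rw [← h2]
    rfl
  have e1 : W.P y {ω | W.hitTilde A ω = ⊤} = W.P y (⋂ n : ℕ, {ω | ∀ k, 1 ≤ k → k ≤ n → W.Y k ω ∉ A}) := by
    apply measure_congr
    filter_upwards [ae_good W y] with ω hω
    apply propext
    refine Iff.trans (hω.2.tilde_iff A) ?_
    rw [show (⋂ n : ℕ, {ω | ∀ k, 1 ≤ k → k ≤ n → W.Y k ω ∉ A}) ω ↔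
      ω ∈ (⋂ n : ℕ, {ω | ∀ k, 1 ≤ k → k ≤ n → W.Y k ω ∉ A}) from Iff.rfl, Set.mem_iInter]
    constructor
    · intro h n k hk _
      obtain ⟨j, rfl⟩ := Nat.exists_eq_succ_of_ne_zero (by omega : k ≠ 0)
      exact h j
    · intro h n
      exact h (n+1) (n+1) (by omega) le_rfl
  have h1 : Filter.Tendsto (fun n => W.P y {ω | ∀ k, 1 ≤ k → k ≤ n → W.Y k ω ∉ A}) Filter.atTop
      (nhds (W.P y (⋂ n : ℕ, {ω | ∀ k, 1 ≤ k → k ≤ n → W.Y k ω ∉ A}))) := by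
    apply tendsto_measure_iInter_atTop
    · intro n
      have : {ω | ∀ k, 1 ≤ k → k ≤ n → W.Y k ω ∉ A} =
        (⋂ k, ⋂ (_ : 1 ≤ k), ⋂ (_ : k ≤ n), (W.Y k ⁻¹' A)ᶜ) := by
        ext ω
        simp
      rw [this]
      exact (MeasurableSet.iInter fun k => MeasurableSet.iInter fun _ => MeasurableSet.iInter fun _ =>
        (W.measurable_Y k hA).compl).nullMeasurableSet
    · intro n m hnm ω hω k h1 h2
      exact hω k h1 (h2.trans hnm)
    · exact ⟨0, measure_ne_top _ _⟩
  rw [← e1] at h1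
  simp only [hst] at h1
  have h2 : Filter.Tendsto (fun n => ENNReal.ofReal (cn A n y)) Filter.atTop (nhds (ENNReal.ofReal (ce A y))) :=
    (ENNReal.continuous_ofReal.tendsto _).comp (cn_tendsto hd A y)
  rw [tendsto_nhds_unique h1 h2, ENNReal.toReal_ofReal (ce_nonneg hd A y)]

lemma cap_eq (hd : 1 ≤ d) (A : Set (Zd d)) (hA : A.Finite) : W.cap A = ∑ a ∈ hA.toFinset, ce A a := by
  unfold SRW.cap
  rw [finsum_eq_sum_of_support_subset (s := hA.toFinset)]
  · exact Finset.sum_congr rfl fun a ha => eqm_eq W hd A a (hA.mem_toFinset.mp ha)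
  · intro a ha
    rw [Finset.mem_coe, hA.mem_toFinset]
    by_contra hc
    exact ha (by simp [SRW.eqm, hc])

lemma entrance_A (hd : 3 ≤ d) (A B : Set (Zd d)) (hA : A.Finite) (hAB : A ⊆ B) (x : Zd d) (hx : x ∉ B) :
    W.P x {ω | W.hit B ω < ⊤ ∧ W.Xat (W.hit B) ω ∈ A} = ENNReal.ofReal (∑ a ∈ hA.toFinset, avg (gg B x) a) := by
  have hB : MeasurableSet B := (Set.to_countable B).measurableSet
  have hav : ∀ a, 0 ≤ avg (gg B x) a := avg_nonneg (gg_nonneg B x)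
  rw [ENNReal.ofReal_sum_of_nonneg (fun a _ => hav a)]
  have e1 : ∀ y ∈ A, W.P x {ω | W.hit B ω < ⊤ ∧ W.Xat (W.hit B) ω = y} =
     W.P x {ω | ∃ N, W.Y N ω = y ∧ ∀ k < N, W.Y k ω ∉ B} := by
    intro y hy
    apply measure_congr
    filter_upwards [ae_good W x] with ω hω
    exact propext (hω.2.hit_iff B y (hAB hy))
  have e2 : W.P x {ω | W.hit B ω < ⊤ ∧ W.Xat (W.hit B) ω ∈ A} =
      W.P x (⋃ y ∈ hA.toFinset, {ω | ∃ N, W.Y N ω = y ∧ ∀ k < N, W.Y k ω ∉ B}) := by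
    apply measure_congr
    filter_upwards [ae_good W x] with ω hω
    apply propext
    rw [show (⋃ y ∈ hA.toFinset, {ω | ∃ N, W.Y N ω = y ∧ ∀ k < N, W.Y k ω ∉ B}) ω ↔
      ω ∈ (⋃ y ∈ hA.toFinset, {ω | ∃ N, W.Y N ω = y ∧ ∀ k < N, W.Y k ω ∉ B}) from Iff.rfl, Set.mem_iUnion₂]
    constructor
    · rintro ⟨h1, h2⟩
      exact ⟨_, hA.mem_toFinset.mpr h2, (hω.2.hit_iff B _ (hAB h2)).mp ⟨h1, rfl⟩⟩
    · rintro ⟨y, hy, h⟩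
      have hy' := hA.mem_toFinset.mp hy
      obtain ⟨h1, h2⟩ := (hω.2.hit_iff B y (hAB hy')).mpr h
      exact ⟨h1, by rw [h2]; exact hy'⟩
  rw [e2, measure_biUnion_finset]
  · refine Finset.sum_congr rfl fun a ha => ?_
    have ha' := hA.mem_toFinset.mp ha
    rw [← e1 a ha', entrance W hd B x a hx (hAB ha')]
  · intro a ha b hb hab
    rw [Function.onFun, Set.disjoint_left]
    rintro ω ⟨N, h1, h2⟩ ⟨M, h3, h4⟩
    have ha' := hAB (hA.mem_toFinset.mp ha)
    have hb' := hAB (hA.mem_toFinset.mp hb)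
    rcases lt_trichotomy N M with h | rfl | h
    · exact h4 N h (h1 ▸ ha')
    · exact hab (h1.symm.trans h3)
    · exact h2 M h (h3 ▸ hb')
  · intro a _
    have : {ω | ∃ N, W.Y N ω = a ∧ ∀ k < N, W.Y k ω ∉ B} =
        ⋃ N, (W.Y N ⁻¹' {a}) ∩ ⋂ k, ⋂ (_ : k < N), (W.Y k ⁻¹' B)ᶜ := by
      ext ω
      simp
    rw [this]
    exact MeasurableSet.iUnion fun N => (W.measurable_Y N (measurableSet_singleton a)).inter
      (MeasurableSet.iInter fun k => MeasurableSet.iInter fun _ => (W.measurable_Y k hB).compl)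

lemma ball_iff (n : ℕ) (z : Zd d) : z ∈ ball (0 : Zd d) n ↔ inb n z := by
  show supDist 0 z ≤ n ↔ _
  unfold supDist inb
  rw [Finset.sup_le_iff]
  constructor
  · intro h i
    have := h i (Finset.mem_univ i)
    simp at this
    rw [abs_le]; omega
  · intro h i _
    have := abs_le.mp (h i)
    simp
    omega

end
end Sol

/-- Proposition 1.5, (1.25): entrance distribution of the walk, started far
away and conditioned to enter `B` through the well-separated piece `A`, is within a factor
`1 ± δ/10` of the normalized equilibrium measure `ē_A`. -/
theorem statement6 {d : ℕ} (hd : 3 ≤ d) {Ω : Type*} [MeasurableSpace Ω] (W : SRW d Ω)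
    (δ : ℝ) (hδ0 : 0 < δ) (hδ1 : δ < 1) :
    ∃ c₃ : ℝ, 2 ≤ c₃ ∧
      ∀ (L K : ℕ), 1 ≤ L → c₃ ≤ (K : ℝ) →
        ∀ A : Set (Zd d), A.Nonempty → A ⊆ ball (0 : Zd d) L →
          ∀ B : Set (Zd d), B.Finite → B ∩ ball (0 : Zd d) (K * L) = A → connSet Bᶜ →
            ∀ y ∈ A, ∀ x : Zd d, x ∉ B ∪ ball (0 : Zd d) (K * L) →
              0 < W.P x {ω | W.hit B ω < ⊤ ∧ W.Xat (W.hit B) ω ∈ A} ∧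
              (1 - δ / 10) * W.ebar A y ≤
                (W.P x {ω | W.hit B ω < ⊤ ∧ W.Xat (W.hit B) ω ∈ A ∧
                    W.Xat (W.hit B) ω = y}).toReal /
                  (W.P x {ω | W.hit B ω < ⊤ ∧ W.Xat (W.hit B) ω ∈ A}).toReal ∧
              (W.P x {ω | W.hit B ω < ⊤ ∧ W.Xat (W.hit B) ω ∈ A ∧
                    W.Xat (W.hit B) ω = y}).toReal /
                  (W.P x {ω | W.hit B ω < ⊤ ∧ W.Xat (W.hit B) ω ∈ A}).toReal
                ≤ (1 + δ / 10) * W.ebar A y := by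
  have hd1 : 1 ≤ d := by omega
  obtain ⟨c, hc, hmain⟩ := Sol.analytic hd δ hδ0 hδ1
  refine ⟨c, hc, ?_⟩
  intro L K hL hK A hAne hAL B hBf hBA hconn y hy x hx
  have hK2 : 2 ≤ K := by exact_mod_cast hc.trans hK
  have hxB : x ∉ B := fun h => hx (Or.inl h)
  have hxK : ¬ Sol.inb (K * L) x := fun h => hx (Or.inr ((Sol.ball_iff _ _).mpr h))
  have hAL' : ∀ a ∈ A, Sol.inb L a := fun a ha => (Sol.ball_iff _ _).mp (hAL ha)
  have hB' : ∀ v, (v ∈ B ∧ Sol.inb (K * L) v) ↔ v ∈ A := by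
    intro v; rw [← hBA, ← Sol.ball_iff]; rfl
  have hAB : A ⊆ B := fun v hv => ((hB' v).mpr hv).1
  have hA : A.Finite := hBf.subset hAB
  obtain ⟨α, β, hα0, hβα, hbd⟩ := hmain L K hL hK A B hAL' hB' x hxB hxK
  obtain ⟨y0, hy0, hpos⟩ := Sol.positivity_aux hd L K hL hK2 A B hAne hAL' hB' x hxB hconn
  have hav : ∀ a, 0 ≤ Sol.avg (Sol.gg B x) a := Sol.avg_nonneg (Sol.gg_nonneg B x)
  have hce : ∀ a, 0 ≤ Sol.ce A a := Sol.ce_nonneg hd1 A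
  have e1 := Sol.entrance_A W hd A B hA hAB x hxB
  have e2 : W.P x {ω | W.hit B ω < ⊤ ∧ W.Xat (W.hit B) ω ∈ A ∧ W.Xat (W.hit B) ω = y} =
      ENNReal.ofReal (Sol.avg (Sol.gg B x) y) := by
    rw [← Sol.entrance W hd B x y hxB (hAB hy)]
    congr 1
    ext ω
    constructor
    · rintro ⟨a, _, b⟩; exact ⟨a, b⟩
    · rintro ⟨a, b⟩
      exact ⟨a, by rw [b]; exact hy, b⟩
  have e3 : W.ebar A y = Sol.ce A y / ∑ a ∈ hA.toFinset, Sol.ce A a := by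
    unfold SRW.ebar
    rw [Sol.cap_eq W hd1 A hA, Sol.eqm_eq W hd1 A y hy]
  obtain ⟨H, hH⟩ : ∃ H, H = ∑ a ∈ hA.toFinset, Sol.avg (Sol.gg B x) a := ⟨_, rfl⟩
  obtain ⟨E, hE⟩ : ∃ E, E = ∑ a ∈ hA.toFinset, Sol.ce A a := ⟨_, rfl⟩
  have hHpos : 0 < H := by
    rw [hH]
    exact lt_of_lt_of_le hpos (Finset.single_le_sum (fun a _ => hav a) (hA.mem_toFinset.mpr hy0))
  have hE0 : 0 ≤ E := by rw [hE]; exact Finset.sum_nonneg fun a _ => hce a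
  have hlow : α * E ≤ H := by
    rw [hE, hH, Finset.mul_sum]
    exact Finset.sum_le_sum fun a ha => (hbd a (hA.mem_toFinset.mp ha)).1
  have hup : H ≤ β * E := by
    rw [hE, hH, Finset.mul_sum]
    exact Finset.sum_le_sum fun a ha => (hbd a (hA.mem_toFinset.mp ha)).2
  have hEpos : 0 < E := by
    rcases hE0.eq_or_lt with h | h
    · rw [← h] at hup; linarith
    · exact h
  have hβpos : 0 < β := by
    by_contra hcon
    have : β * E ≤ 0 := mul_nonpos_of_nonpos_of_nonneg (not_lt.mp hcon) hE0
    linarith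
  have hαpos : 0 < α := by
    rcases hα0.eq_or_lt with h | h
    · rw [← h] at hβα; linarith
    · exact h
  obtain ⟨hy1, hy2⟩ := hbd y hy
  have hcy := hce y
  rw [e1, e2, e3, ← hH, ← hE, ENNReal.toReal_ofReal (hav y), ENNReal.toReal_ofReal hHpos.le]
  refine ⟨by rwa [ENNReal.ofReal_pos], ?_, ?_⟩
  · rw [← mul_div_assoc, div_le_div_iff₀ hEpos hHpos]
    have h1 : (1 - δ / 10) * β ≤ α := by
      have : (1 - δ / 10) * β ≤ (1 - δ / 10) * ((1 + δ / 10) * α) :=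
        mul_le_mul_of_nonneg_left hβα (by linarith)
      have h2 : 0 ≤ (δ / 10) ^ 2 * α := by positivity
      have h3 : (1 - δ / 10) * ((1 + δ / 10) * α) = α - (δ / 10) ^ 2 * α := by ring
      linarith
    calc (1 - δ / 10) * Sol.ce A y * H ≤ (1 - δ / 10) * Sol.ce A y * (β * E) :=
          mul_le_mul_of_nonneg_left hup (mul_nonneg (by linarith) hcy)
      _ = (1 - δ / 10) * β * (Sol.ce A y * E) := by ring
      _ ≤ α * (Sol.ce A y * E) := mul_le_mul_of_nonneg_right h1 (by positivity)
      _ = (α * Sol.ce A y) * E := by ring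
      _ ≤ _ := mul_le_mul_of_nonneg_right hy1 hE0
  · rw [← mul_div_assoc, div_le_div_iff₀ hHpos hEpos]
    calc _ ≤ β * Sol.ce A y * E := mul_le_mul_of_nonneg_right hy2 hE0
      _ = β * (Sol.ce A y * E) := by ring
      _ ≤ ((1 + δ / 10) * α) * (Sol.ce A y * E) := mul_le_mul_of_nonneg_right hβα (by positivity)
      _ = (1 + δ / 10) * Sol.ce A y * (α * E) := by ring
      _ ≤ _ := mul_le_mul_of_nonneg_left hlow (mul_nonneg (by linarith) hcy)
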